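/- Consider the piecewise polynomial holomorphic system ż = iz + ε·h^σ(z) for z ∈ Σ_σ (σ = +, c, −), where h^σ(z) = Σ_{j=0}^{4} (a_j^σ + i b_j^σ) z^j with real coefficients a_j^σ, b_j^σ. There exist real coefficients a_j^σ, b_j^σ (0 ≤ j ≤ 4, σ = +, c, −) and ε₀ > 0 such that for every ε with 0 < ε < ε₀ the system has at least 4 crossing limit cycles, bifurcating from the periodic orbits of the linear center ż = iz. -/

import Mathlib

open Complex Set

/-- A *crossing periodic orbit* of the piecewise system `z' = fields σ z` for `z ∈ zones σ`,
where the discontinuity set is the union of the zero sets of the functions in `curves`: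
a nonconstant continuous `T`-periodic curve, satisfying the differential equation of each
zone inside that (open) zone, meeting the discontinuity set at only finitely many times per
period, and crossing it transversally there (at each such point the two one-sided vector
fields have nonzero normal component to the discontinuity curve, of the same sign; the normal
direction is given by the gradient, i.e. the Fréchet derivative, of the defining function of
the curve). -/
def IsCrossingPeriodicOrbit {ι : Type} (zones : ι → Set ℂ) (fields : ι → ℂ → ℂ)
    (curves : Set (ℂ → ℝ)) (z : ℝ → ℂ) : Prop :=
  ∃ T : ℝ, 0 < T ∧
    Continuous z ∧ Function.Periodic z T ∧ (∃ s t : ℝ, z s ≠ z t) ∧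
    (∀ (t : ℝ) (σ : ι), z t ∈ zones σ → HasDerivAt z (fields σ (z t)) t) ∧
    {t ∈ Set.Ico (0:ℝ) T | ∃ g ∈ curves, g (z t) = 0}.Finite ∧
    (∀ t : ℝ, (∃ g ∈ curves, g (z t) = 0) →
      ∃ σ₁ σ₂ : ι, σ₁ ≠ σ₂ ∧
        (∃ ε > 0, (∀ s ∈ Set.Ioo (t - ε) t, z s ∈ zones σ₁) ∧
                  (∀ s ∈ Set.Ioo t (t + ε), z s ∈ zones σ₂)) ∧
        (∀ g ∈ curves, g (z t) = 0 →
          fderiv ℝ g (z t) (fields σ₁ (z t)) ≠ 0 ∧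
          fderiv ℝ g (z t) (fields σ₂ (z t)) ≠ 0 ∧
          (0 < fderiv ℝ g (z t) (fields σ₁ (z t)) ↔
           0 < fderiv ℝ g (z t) (fields σ₂ (z t)))))

/-- A *crossing limit cycle*: a crossing periodic orbit whose image is isolated among
the images of crossing periodic orbits. -/
def IsCrossingLimitCycle {ι : Type} (zones : ι → Set ℂ) (fields : ι → ℂ → ℂ)
    (curves : Set (ℂ → ℝ)) (z : ℝ → ℂ) : Prop :=
  IsCrossingPeriodicOrbit zones fields curves z ∧
  ∃ U : Set ℂ, IsOpen U ∧ Set.range z ⊆ U ∧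
    ∀ w : ℝ → ℂ, IsCrossingPeriodicOrbit zones fields curves w →
      Set.range w ⊆ U → Set.range w = Set.range z

/-- The three zones separated by the parallel lines `Im z = 1` and `Im z = -1`:
`Σ₊ = {Im z > 1}`, `Σ_c = {|Im z| < 1}`, `Σ₋ = {Im z < -1}`. -/
def zonesLines : Fin 3 → Set ℂ :=
  ![{z : ℂ | 1 < z.im}, {z : ℂ | |z.im| < 1}, {z : ℂ | z.im < -1}]

/-- The discontinuity curves `Im z = 1` and `Im z = -1`, given by level functions. -/
def curvesLines : Set (ℂ → ℝ) :=
  {fun z => z.im - 1, fun z => z.im + 1}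


open Filter Topology Metric

/-- Standing smallness hypotheses on the perturbation. -/
structure SmallPert (e : ℂ → ℂ) (μ : ℝ) : Prop where
  diff : Differentiable ℂ e
  bd : ∀ z : ℂ, ‖z‖ ≤ 200 → ‖e z‖ ≤ 1 / 10 ^ 5
  mu : |μ| ≤ 1 / 10 ^ 5

/-- The piecewise field: perturbed above, linear focus in the other two zones. -/
noncomputable def pwField (e : ℂ → ℂ) (μ : ℝ) : Fin 3 → ℂ → ℂ :=
  ![fun z => I * z + e z, fun z => (I + (μ : ℂ)) * z, fun z => (I + (μ : ℂ)) * z]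

/-- sign of a right derivative -/
lemma right_deriv_neg {u : ℝ → ℝ} {d t : ℝ} (h : HasDerivWithinAt u d (Ici t) t) (hd : d < 0) :
    ∀ᶠ s in 𝓝[>] t, u s < u t := by
  have h1 := h.Ioi_of_Ici
  rw [hasDerivWithinAt_iff_tendsto_slope' (by simp)] at h1
  filter_upwards [h1.eventually (gt_mem_nhds hd), self_mem_nhdsWithin] with s hs hst
  have hst' : t < s := hst
  rw [slope_def_field] at hs
  have : 0 < s - t := sub_pos.2 hst'
  rw [div_lt_iff₀ this] at hs
  linarith

lemma right_deriv_pos {u : ℝ → ℝ} {d t : ℝ} (h : HasDerivWithinAt u d (Ici t) t) (hd : 0 < d) :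
    ∀ᶠ s in 𝓝[>] t, u t < u s := by
  have := right_deriv_neg (u := fun s => - u s) h.neg (by linarith)
  filter_upwards [this] with s hs
  linarith

lemma left_deriv_neg {u : ℝ → ℝ} {d t : ℝ} (h : HasDerivAt u d t) (hd : d < 0) :
    ∀ᶠ s in 𝓝[<] t, u t < u s := by
  have h1 := h.hasDerivWithinAt (s := Iio t)
  rw [hasDerivWithinAt_iff_tendsto_slope' (by simp)] at h1
  filter_upwards [h1.eventually (gt_mem_nhds hd), self_mem_nhdsWithin] with s hs hst
  have hst' : s < t := hst
  rw [slope_def_field] at hs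
  have : s - t < 0 := sub_neg.2 hst'
  rw [div_lt_iff_of_neg this] at hs
  linarith

lemma left_deriv_pos {u : ℝ → ℝ} {d t : ℝ} (h : HasDerivAt u d t) (hd : 0 < d) :
    ∀ᶠ s in 𝓝[<] t, u s < u t := by
  have := left_deriv_neg (u := fun s => - u s) h.neg (by linarith)
  filter_upwards [this] with s hs
  linarith

lemma hasDerivWithinAt_im {w : ℝ → ℂ} {d : ℂ} {s : Set ℝ} {t : ℝ} (h : HasDerivWithinAt w d s t) :
    HasDerivWithinAt (fun t => (w t).im) d.im s t :=
  (imCLM.hasFDerivAt.comp_hasDerivWithinAt t h)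

lemma hasDerivAt_im {w : ℝ → ℂ} {d : ℂ} {t : ℝ} (h : HasDerivAt w d t) :
    HasDerivAt (fun t => (w t).im) d.im t :=
  (imCLM.hasFDerivAt.comp_hasDerivAt t h)

/-- Right derivative obtained from the differential equation on the right. -/
lemma right_deriv_of_eventually {w : ℝ → ℂ} {f : ℂ → ℂ} (hw : Continuous w) (hf : Continuous f)
    {t : ℝ} (h : ∀ᶠ s in 𝓝[>] t, HasDerivAt w (f (w s)) s) :
    HasDerivWithinAt w (f (w t)) (Ici t) t := by
  refine hasDerivWithinAt_Ici_of_tendsto_deriv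
    (s := {s | HasDerivAt w (f (w s)) s})
    (fun s hs => (HasDerivAt.differentiableAt hs).differentiableWithinAt)
    hw.continuousWithinAt h ?_
  have h2 : Tendsto (fun s => f (w s)) (𝓝[>] t) (𝓝 (f (w t))) :=
    ((hf.comp hw).tendsto t).mono_left nhdsWithin_le_nhds
  refine h2.congr' ?_
  filter_upwards [h] with s hs
  exact hs.deriv.symm

/-- local forward uniqueness -/
lemma local_follow {w γ : ℝ → ℂ} {f : ℂ → ℂ} (hw : Continuous w) (hf : ContDiff ℝ 1 f)
    {a b : ℝ} (h : ∀ᶠ s in 𝓝[>] a, HasDerivAt w (f (w s)) s)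
    (hb : a < b) (hγ : ∀ s ∈ Ico a b, HasDerivAt γ (f (γ s)) s) (heq : w a = γ a) :
    ∃ c ∈ Ioo a b, ∀ s ∈ Icc a c, w s = γ s := by
  obtain ⟨K, V, hV, hK⟩ := (hf.contDiffAt (x := w a)).exists_lipschitzOnWith
  have hγa : HasDerivAt γ (f (γ a)) a := hγ a ⟨le_rfl, hb⟩
  have e1 : ∀ᶠ s in 𝓝[>] a, w s ∈ V :=
    (hw.tendsto a).eventually hV |>.filter_mono nhdsWithin_le_nhds
  have e2 : ∀ᶠ s in 𝓝[>] a, γ s ∈ V :=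
    (hγa.continuousAt.tendsto.eventually (heq ▸ hV)).filter_mono nhdsWithin_le_nhds
  have e3 : ∀ᶠ s in 𝓝[>] a, s < b := (gt_mem_nhds hb).filter_mono nhdsWithin_le_nhds
  have e := (h.and (e1.and (e2.and e3)))
  rw [eventually_nhdsWithin_iff, Metric.eventually_nhds_iff] at e
  obtain ⟨η, hη, e⟩ := e
  have e' : ∀ s ∈ Ioo a (a + η), HasDerivAt w (f (w s)) s ∧ w s ∈ V ∧ γ s ∈ V ∧ s < b := by
    intro s hs
    exact e (by rw [Real.dist_eq, abs_lt]; constructor <;> linarith [hs.1, hs.2]) hs.1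
  have hcb := e' (a + η / 2) ⟨by linarith, by linarith⟩
  refine ⟨a + η / 2, ⟨by linarith, hcb.2.2.2⟩, ?_⟩
  have hVa : w a ∈ V := mem_of_mem_nhds hV
  refine ODE_solution_unique_of_mem_Icc_right (v := fun _ => f) (s := fun _ => V) (K := K)
    (fun _ _ => hK) hw.continuousOn ?_ ?_ ?_ ?_ ?_ heq
  · intro t ht
    rcases eq_or_lt_of_le ht.1 with h1 | h1
    · subst h1
      exact right_deriv_of_eventually hw hf.continuous h
    · exact (e' t ⟨h1, by linarith [ht.2]⟩).1.hasDerivWithinAt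
  · intro t ht
    rcases eq_or_lt_of_le ht.1 with h1 | h1
    · subst h1; exact hVa
    · exact (e' t ⟨h1, by linarith [ht.2]⟩).2.1
  · intro t ht
    exact (hγ t ⟨ht.1, lt_of_le_of_lt ht.2 hcb.2.2.2⟩).continuousAt.continuousWithinAt
  · intro t ht
    exact (hγ t ⟨ht.1, lt_trans ht.2 hcb.2.2.2⟩).hasDerivWithinAt
  · intro t ht
    rcases eq_or_lt_of_le ht.1 with h1 | h1
    · subst h1; exact heq ▸ hVa
    · exact (e' t ⟨h1, by linarith [ht.2]⟩).2.2.1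

/-- forward uniqueness along a reference arc contained in an open set `V`. -/
lemma follow {w γ : ℝ → ℂ} {f : ℂ → ℂ} {V : Set ℂ} (hV : IsOpen V)
    (hw : Continuous w) (hf : ContDiff ℝ 1 f)
    (hwd : ∀ t, (∀ᶠ s in 𝓝[>] t, w s ∈ V) → ∀ᶠ s in 𝓝[>] t, HasDerivAt w (f (w s)) s)
    {S t0 : ℝ} (hγ : ∀ s ∈ Icc 0 S, HasDerivAt γ (f (γ s)) s)
    (hγV : ∀ s ∈ Ioo 0 S, γ s ∈ V) (h0 : w t0 = γ 0) (hs0 : ∀ᶠ s in 𝓝[>] t0, w s ∈ V) :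
    ∀ s ∈ Icc 0 S, w (t0 + s) = γ s := by
  set w' : ℝ → ℂ := fun s => w (t0 + s) with hw'
  have hw'c : Continuous w' := by fun_prop
  have hshift : ∀ a, Tendsto (fun s => t0 + s) (𝓝[>] a) (𝓝[>] (t0 + a)) := by
    intro a
    refine tendsto_nhdsWithin_iff.2 ⟨?_, ?_⟩
    · exact ((continuous_const.add continuous_id).tendsto a).mono_left nhdsWithin_le_nhds
    · filter_upwards [self_mem_nhdsWithin] with s hs
      have : a < s := hs
      simp [this]
  have hcont : ContinuousOn γ (Icc 0 S) := fun s hs => (hγ s hs).continuousAt.continuousWithinAt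
  by_cases hS : 0 ≤ S
  swap
  · intro s hs; exact absurd (hs.1.trans hs.2) hS
  refine IsClosed.Icc_subset_of_forall_exists_gt (s := {s | w' s = γ s}) ?_ ?_ ?_
  · have : {s | w' s = γ s} ∩ Icc 0 S = Icc 0 S ∩ (fun s => w' s - γ s) ⁻¹' {0} := by
      ext s; simp [sub_eq_zero, and_comm]
    rw [this]
    exact (hw'c.continuousOn.sub hcont).preimage_isClosed_of_isClosed isClosed_Icc isClosed_singleton
  · simp [hw', h0]
  · rintro s ⟨hs, hs2⟩ y hy
    have hsy : s < y := hy
    have hev : ∀ᶠ r in 𝓝[>] (t0 + s), w r ∈ V := by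
      rcases eq_or_lt_of_le hs2.1 with h1 | h1
      · rw [← h1]; simpa using hs0
      · have : w (t0 + s) ∈ V := by
          have : w' s = γ s := hs
          rw [hw'] at this
          simp only at this
          rw [this]; exact hγV s ⟨h1, hs2.2⟩
        exact (hw.tendsto _).eventually (hV.mem_nhds this) |>.filter_mono nhdsWithin_le_nhds
    have hder := (hshift s).eventually (hwd _ hev)
    have hder' : ∀ᶠ r in 𝓝[>] s, HasDerivAt w' (f (w' r)) r := by
      filter_upwards [hder] with r hr
      simpa [hw', add_comm] using hr.comp_const_add t0 r
    obtain ⟨c, hc, hcc⟩ := local_follow hw'c hf hder' (lt_min hsy hs2.2)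
      (fun r hr => hγ r ⟨hs2.1.trans hr.1, (hr.2.trans_le (min_le_right _ _)).le⟩) hs
    exact ⟨c, hcc c ⟨hc.1.le, le_rfl⟩, hc.1, (hc.2.trans_le (min_le_left _ _)).le⟩


lemma mem_zone0 {z : ℂ} : z ∈ zonesLines 0 ↔ 1 < z.im := by simp [zonesLines]
lemma mem_zone1 {z : ℂ} : z ∈ zonesLines 1 ↔ |z.im| < 1 := by simp [zonesLines]
lemma mem_zone2 {z : ℂ} : z ∈ zonesLines 2 ↔ z.im < -1 := by simp [zonesLines]

lemma pwField0 (e : ℂ → ℂ) (μ : ℝ) (z : ℂ) : pwField e μ 0 z = I * z + e z := rfl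
lemma pwField1 (e : ℂ → ℂ) (μ : ℝ) (z : ℂ) : pwField e μ 1 z = (I + (μ : ℂ)) * z := rfl
lemma pwField2 (e : ℂ → ℂ) (μ : ℝ) (z : ℂ) : pwField e μ 2 z = (I + (μ : ℂ)) * z := rfl

lemma curves_iff {z : ℂ} : (∃ g ∈ curvesLines, g z = 0) ↔ z.im = 1 ∨ z.im = -1 := by
  simp only [curvesLines, mem_insert_iff, mem_singleton_iff, exists_eq_or_imp, exists_eq_left]
  constructor
  · rintro (h | h)
    · left; linarith
    · right; linarith
  · rintro (h | h)
    · left; linarith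
    · right; linarith

lemma fin3_cases (σ : Fin 3) : σ = 0 ∨ σ = 1 ∨ σ = 2 := by
  fin_cases σ <;> simp

lemma zone_open (σ : Fin 3) : IsOpen (zonesLines σ) := by
  rcases fin3_cases σ with h | h | h <;> subst h
  · exact isOpen_lt continuous_const continuous_im
  · exact isOpen_lt continuous_im.abs continuous_const
  · exact isOpen_lt continuous_im continuous_const

lemma pwField_cont {e : ℂ → ℂ} {μ : ℝ} (h : Differentiable ℂ e) (σ : Fin 3) :
    ContDiff ℝ 1 (pwField e μ σ) := by
  have he : ContDiff ℝ 1 e := (h.contDiff (n := 1)).restrict_scalars ℝ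
  rcases fin3_cases σ with h | h | h <;> subst h
  · show ContDiff ℝ 1 (fun z => I * z + e z)
    fun_prop
  · show ContDiff ℝ 1 (fun z : ℂ => (I + (μ : ℂ)) * z)
    fun_prop
  · show ContDiff ℝ 1 (fun z : ℂ => (I + (μ : ℂ)) * z)
    fun_prop

section orbit

variable {e : ℂ → ℂ} {μ : ℝ} {w : ℝ → ℂ}

lemma orbit_continuous (hw : IsCrossingPeriodicOrbit zonesLines (pwField e μ) curvesLines w) :
    Continuous w := by
  obtain ⟨T, _, h, _⟩ := hw; exact h

lemma orbit_right_zone (hw : IsCrossingPeriodicOrbit zonesLines (pwField e μ) curvesLines w)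
    (t : ℝ) : ∃ σ, ∀ᶠ s in 𝓝[>] t, w s ∈ zonesLines σ := by
  have hc := orbit_continuous hw
  obtain ⟨T, hT, -, hper, -, hder, -, hcr⟩ := hw
  by_cases h : ∃ g ∈ curvesLines, g (w t) = 0
  · obtain ⟨σ₁, σ₂, -, ⟨η, hη, -, h2⟩, -⟩ := hcr t h
    refine ⟨σ₂, ?_⟩
    filter_upwards [Ioo_mem_nhdsGT (show t < t + η by linarith)] with s hs
    exact h2 s hs
  · rw [curves_iff] at h
    push Not at h
    have : ∃ σ, w t ∈ zonesLines σ := by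
      rcases lt_trichotomy (w t).im 1 with h1 | h1 | h1
      · rcases lt_trichotomy (w t).im (-1) with h2 | h2 | h2
        · exact ⟨2, mem_zone2.2 h2⟩
        · exact absurd h2 h.2
        · exact ⟨1, mem_zone1.2 (abs_lt.2 ⟨h2, h1⟩)⟩
      · exact absurd h1 h.1
      · exact ⟨0, mem_zone0.2 h1⟩
    obtain ⟨σ, hσ⟩ := this
    exact ⟨σ, ((hc.tendsto t).eventually ((zone_open σ).mem_nhds hσ)).filter_mono
      nhdsWithin_le_nhds⟩

lemma orbit_deriv (hw : IsCrossingPeriodicOrbit zonesLines (pwField e μ) curvesLines w)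
    {t : ℝ} {σ : Fin 3} (h : w t ∈ zonesLines σ) : HasDerivAt w (pwField e μ σ (w t)) t := by
  obtain ⟨T, hT, -, hper, -, hder, -, hcr⟩ := hw
  exact hder t σ h

lemma orbit_right_deriv (hs : SmallPert e μ)
    (hw : IsCrossingPeriodicOrbit zonesLines (pwField e μ) curvesLines w)
    {t : ℝ} {σ : Fin 3} (h : ∀ᶠ s in 𝓝[>] t, w s ∈ zonesLines σ) :
    HasDerivWithinAt w (pwField e μ σ (w t)) (Ici t) t := by
  refine right_deriv_of_eventually (orbit_continuous hw) (pwField_cont hs.diff σ).continuous ?_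
  filter_upwards [h] with s hs
  exact orbit_deriv hw hs

lemma orbit_upper (hw : IsCrossingPeriodicOrbit zonesLines (pwField e μ) curvesLines w) (t : ℝ)
    (h : ∀ᶠ s in 𝓝[>] t, w s ∈ {z : ℂ | 1 < z.im}) :
    ∀ᶠ s in 𝓝[>] t, HasDerivAt w (pwField e μ 0 (w s)) s := by
  filter_upwards [h] with s hs
  exact orbit_deriv hw (mem_zone0.2 hs)

lemma orbit_lower (hw : IsCrossingPeriodicOrbit zonesLines (pwField e μ) curvesLines w) (t : ℝ)
    (h : ∀ᶠ s in 𝓝[>] t, w s ∈ {z : ℂ | z.im < 1}) :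
    ∀ᶠ s in 𝓝[>] t, HasDerivAt w (pwField e μ 1 (w s)) s := by
  obtain ⟨σ, hσ⟩ := orbit_right_zone hw t
  filter_upwards [h, hσ] with s hs hs2
  have := orbit_deriv hw hs2
  rcases fin3_cases σ with h | h | h <;> subst h
  · rw [mem_zone0] at hs2
    exact absurd hs2 (not_lt.2 (le_of_lt hs))
  · exact this
  · exact this

lemma field0_im (hs : SmallPert e μ) {z : ℂ} (hz : ‖z‖ ≤ 200) :
    |(pwField e μ 0 z).im - z.re| ≤ 1 / 10 ^ 5 := by
  have := (abs_im_le_norm (e z)).trans (hs.bd z hz)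
  simpa [pwField0] using this

lemma field1_im (z : ℂ) : (pwField e μ 1 z).im = z.re + μ * z.im := by
  simp [pwField1]; ring

lemma orbit_enter_lower (hs : SmallPert e μ)
    (hw : IsCrossingPeriodicOrbit zonesLines (pwField e μ) curvesLines w) {t y : ℝ}
    (hy : 1 / 100 ≤ y) (hy2 : y ≤ 100) (ht : w t = -(y : ℂ) + I) :
    ∀ᶠ s in 𝓝[>] t, w s ∈ {z : ℂ | z.im < 1} := by
  obtain ⟨σ, hσ⟩ := orbit_right_zone hw t
  have him : (w t).im = 1 := by simp [ht]
  have hn : ‖w t‖ ≤ 200 := by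
    rw [ht]
    refine (norm_add_le _ _).trans ?_
    simp [abs_of_nonneg (show 0 ≤ y by linarith)]; linarith
  rcases fin3_cases σ with h | h | h <;> subst h
  · have h1 := hasDerivWithinAt_im (orbit_right_deriv hs hw hσ)
    have h2 := abs_le.1 (field0_im hs hn)
    have h3 : (w t).re = -y := by simp [ht]
    have := right_deriv_neg h1 (by rw [h3] at h2; norm_num at h2 ⊢; linarith)
    filter_upwards [this] with s hs
    simpa [him] using hs
  · filter_upwards [hσ] with s hs
    rw [mem_zone1, abs_lt] at hs
    exact hs.2
  · filter_upwards [hσ] with s hs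
    rw [mem_zone2] at hs
    show (w s).im < 1
    linarith

lemma orbit_enter_upper (hs : SmallPert e μ)
    (hw : IsCrossingPeriodicOrbit zonesLines (pwField e μ) curvesLines w) {t x : ℝ}
    (hx : 1 / 100 ≤ x) (ht : w t = (x : ℂ) + I) :
    ∀ᶠ s in 𝓝[>] t, w s ∈ {z : ℂ | 1 < z.im} := by
  obtain ⟨σ, hσ⟩ := orbit_right_zone hw t
  have him : (w t).im = 1 := by simp [ht]
  have hre : (w t).re = x := by simp [ht]
  have hmu := abs_le.1 hs.mu
  have key : 0 < (pwField e μ 1 (w t)).im := by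
    rw [field1_im, him, hre]; norm_num at hmu; linarith
  rcases fin3_cases σ with h | h | h <;> subst h
  · filter_upwards [hσ] with s hs
    exact mem_zone0.1 hs
  all_goals
    have h1 := hasDerivWithinAt_im (orbit_right_deriv hs hw hσ)
    have := right_deriv_pos h1 key
    filter_upwards [this] with s hs
    simpa [him] using hs

/-- An orbit in the annulus must meet the left half line. -/
lemma orbit_meets (hs : SmallPert e μ)
    (hw : IsCrossingPeriodicOrbit zonesLines (pwField e μ) curvesLines w)
    (hann : ∀ t, 101 / 100 < ‖w t‖ ∧ ‖w t‖ < 7) :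
    ∃ t y : ℝ, 0 ≤ y ∧ w t = -(y : ℂ) + I := by
  by_contra hcon
  push Not at hcon
  have hslit : ∀ t, w t - I ∈ slitPlane := by
    intro t
    rw [mem_slitPlane_iff]
    by_contra h
    push Not at h
    simp only [sub_re, I_re, sub_zero, sub_im, I_im] at h
    refine hcon t (-(w t).re) (by linarith [h.1]) ?_
    apply Complex.ext <;> simp
    linarith [h.2]
  have hc := orbit_continuous hw
  set A : ℝ → ℝ := fun t => (Complex.log (w t - I)).im with hA
  have hAc : Continuous A := by
    refine continuous_im.comp ?_
    exact Continuous.clog (by fun_prop) hslit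
  have hAd : ∀ t, ∃ d, 0 < d ∧ HasDerivWithinAt A d (Ici t) t := by
    intro t
    obtain ⟨σ, hσ⟩ := orbit_right_zone hw t
    have h1 := (((orbit_right_deriv hs hw hσ).sub_const I).clog_real (hslit t))
    refine ⟨_, ?_, hasDerivWithinAt_im h1⟩
    obtain ⟨ha1, ha2⟩ := hann t
    have hmu := hs.mu
    obtain ⟨E, hE, hfE⟩ : ∃ E : ℂ, ‖E‖ ≤ 1 / 1000 ∧ pwField e μ σ (w t) = I * w t + E := by
      have hm : ‖(μ : ℂ) * w t‖ ≤ 1 / 1000 := by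
        rw [norm_mul, norm_real, Real.norm_eq_abs]
        calc |μ| * ‖w t‖ ≤ 1 / 10 ^ 5 * 7 := by gcongr
          _ ≤ _ := by norm_num
      rcases fin3_cases σ with h | h | h <;> subst h
      · exact ⟨e (w t), (hs.bd _ (by linarith)).trans (by norm_num), rfl⟩
      · exact ⟨μ * w t, hm, by rw [pwField1]; ring⟩
      · exact ⟨μ * w t, hm, by rw [pwField2]; ring⟩
    rw [hfE]
    have hne : w t - I ≠ 0 := slitPlane_ne_zero (hslit t)
    have hns : 0 < normSq (w t - I) := normSq_pos.2 hne
    have hEre := (abs_le.1 ((abs_re_le_norm E).trans hE))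
    have hEim := (abs_le.1 ((abs_im_le_norm E).trans hE))
    have hre := abs_le.1 (abs_re_le_norm (w t))
    have him := abs_le.1 (abs_im_le_norm (w t))
    have hsq : ‖w t‖ ^ 2 = (w t).re ^ 2 + (w t).im ^ 2 := by
      rw [← normSq_eq_norm_sq, normSq_apply]; ring
    have key : ((I * w t + E) / (w t - I)).im * normSq (w t - I)
        = (w t).re ^ 2 + (w t).im ^ 2 - (w t).im
          + (E.im * (w t).re - E.re * ((w t).im - 1)) := by
      rw [div_im]
      field_simp
      simp
      ring
    have hpos : 0 < (w t).re ^ 2 + (w t).im ^ 2 - (w t).im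
          + (E.im * (w t).re - E.re * ((w t).im - 1)) := by
      have b1 : |E.im * (w t).re| ≤ 1 / 1000 * 7 * (1/7 * ‖w t‖) := by
        rw [abs_mul]
        have := (abs_im_le_norm E).trans hE
        have := abs_re_le_norm (w t)
        calc |E.im| * |(w t).re| ≤ 1 / 1000 * ‖w t‖ := by gcongr
          _ = _ := by ring
      have b2 : |E.re * ((w t).im - 1)| ≤ 1 / 1000 * (‖w t‖ + 1) := by
        rw [abs_mul]
        have h1 := (abs_re_le_norm E).trans hE
        have h2 : |(w t).im - 1| ≤ ‖w t‖ + 1 := by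
          rw [abs_le]; constructor <;> linarith [him.1, him.2]
        gcongr
      have b1' := abs_le.1 b1
      have b2' := abs_le.1 b2
      nlinarith [him.2, ha1, ha2]
    rw [← key] at hpos
    exact pos_of_mul_pos_left hpos hns.le
  obtain ⟨T, hT, -, hper, -⟩ := hw
  have hAper : Function.Periodic A T := fun t => by simp [hA, hper t]
  obtain ⟨tm, -, hmax⟩ := (isCompact_Icc (a := (0:ℝ)) (b := T)).exists_isMaxOn
    ⟨0, by simp [hT.le]⟩ hAc.continuousOn
  have hmax' : ∀ t, A t ≤ A tm := by
    intro t
    obtain ⟨s, hs1, hs2⟩ := hAper.exists_mem_Ico₀ hT t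
    rw [hs2]
    exact hmax (Ico_subset_Icc_self hs1)
  obtain ⟨d, hd, hdd⟩ := hAd tm
  obtain ⟨s, hs⟩ := (right_deriv_pos hdd hd).exists
  exact absurd (hmax' s) (not_le.2 hs)

end orbit


section upper
variable {e : ℂ → ℂ} {μ : ℝ}

/-- existence of the perturbed rotation for a long time -/
lemma flow_exists (hs : SmallPert e μ) {p : ℂ} (hp : ‖p‖ ≤ 100) :
    ∃ γ : ℝ → ℂ, γ 0 = p ∧ (∀ t ∈ Ioo (-1 : ℝ) 4, HasDerivAt γ (pwField e μ 0 (γ t)) t) ∧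
      ∀ t ∈ Ioo (-1 : ℝ) 4, ‖γ t - Complex.exp (I * t) * p‖ ≤ 1 / 1000 := by
  have hexp : ∀ t : ℝ, ‖Complex.exp (I * t)‖ = 1 := by
    intro t; rw [mul_comm]; exact norm_exp_ofReal_mul_I t
  have hexp' : ∀ t : ℝ, ‖Complex.exp (-(I * t))‖ = 1 := by
    intro t
    rw [Complex.exp_neg, norm_inv, hexp]; simp
  set v : ℝ → ℂ → ℂ := fun t u => Complex.exp (-(I * t)) * e (Complex.exp (I * t) * u) with hv
  have hball : ∀ (t : ℝ), ∀ u ∈ closedBall p (1 / 1000 : ℝ),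
      Complex.exp (I * t) * u ∈ closedBall (0 : ℂ) 200 := by
    intro t u hu
    rw [mem_closedBall, dist_eq_norm] at hu
    rw [mem_closedBall, dist_zero_right, norm_mul, hexp, one_mul]
    calc ‖u‖ = ‖(u - p) + p‖ := by ring_nf
      _ ≤ ‖u - p‖ + ‖p‖ := norm_add_le _ _
      _ ≤ 200 := by linarith
  obtain ⟨K, hK⟩ : ∃ K, LipschitzOnWith K e (closedBall 0 200) := by
    have he : ContDiff ℝ 1 e := (hs.diff.contDiff (n := 1)).restrict_scalars ℝ
    exact he.contDiffOn.exists_lipschitzOnWith (by norm_num) (convex_closedBall _ _)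
      (isCompact_closedBall _ _)
  have hPL : IsPicardLindelof v (tmin := -1) (tmax := 4) ⟨0, by norm_num⟩ p
      (1 / 1000) 0 (1 / 10 ^ 5) K := by
    refine ⟨?_, ?_, ?_, ?_⟩
    · intro t _
      refine LipschitzOnWith.of_dist_le_mul fun a ha b hb => ?_
      have ha' := hball t a (by simpa using ha)
      have hb' := hball t b (by simpa using hb)
      have := hK.dist_le_mul _ ha' _ hb'
      simp only [hv, dist_eq_norm, ← mul_sub, norm_mul, hexp, hexp', one_mul] at this ⊢
      exact this
    · intro x _
      have := hs.diff.continuous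
      simp only [hv]
      fun_prop
    · intro t _ x hx
      have := hball t x (by simpa using hx)
      simp only [hv, norm_mul, hexp', one_mul]
      refine (hs.bd _ (by simpa using this)).trans ?_
      simp
    · norm_num
  obtain ⟨α, hα0, hα, hαm⟩ : ∃ α : ℝ → ℂ, α 0 = p ∧
      (∀ t ∈ Icc (-1 : ℝ) 4, HasDerivWithinAt α (v t (α t)) (Icc (-1) 4) t) ∧
      ∀ t, α t ∈ closedBall p (1 / 1000 : ℝ) := by
    obtain ⟨α, hα⟩ := ODE.FunSpace.exists_isFixedPt_next hPL (mem_closedBall_self le_rfl)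
    refine ⟨α.compProj, ?_, fun t ht => ?_, fun t => ?_⟩
    · have := ODE.FunSpace.compProj_val (α := α) (t := ⟨0, by norm_num⟩)
      simp only at this
      rw [this, ← hα, ODE.FunSpace.next_apply₀]
    · apply ODE.hasDerivWithinAt_picard_Icc (t₀ := 0) (by norm_num) hPL.continuousOn_uncurry
        α.continuous_compProj.continuousOn
        (fun _ ht' ↦ α.compProj_mem_closedBall hPL.mul_max_le)
        p ht |>.congr_of_mem _ ht
      intro t' ht'
      nth_rw 1 [← hα]
      rw [ODE.FunSpace.compProj_of_mem ht', ODE.FunSpace.next_apply]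
    · have := α.compProj_mem_closedBall hPL.mul_max_le (t := t)
      simpa using this
  refine ⟨fun t => Complex.exp (I * t) * α t, by simp [hα0], ?_, ?_⟩
  · intro t ht
    have h1 : HasDerivAt α (v t (α t)) t :=
      (hα t (Ioo_subset_Icc_self ht)).hasDerivAt (Icc_mem_nhds ht.1 ht.2)
    have h2 : HasDerivAt (fun t : ℝ => Complex.exp (I * t)) (Complex.exp (I * t) * I) t := by
      have : HasDerivAt (fun t : ℝ => I * (t : ℂ)) (I * 1) t :=
        (Complex.ofRealCLM.hasDerivAt (x := t)).const_mul I
      simpa using this.cexp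
    have h3 := h2.mul h1
    refine HasDerivAt.congr_deriv h3 ?_
    rw [pwField0]
    simp only [hv]
    have : Complex.exp (I * t) * Complex.exp (-(I * t)) = 1 := by
      rw [← Complex.exp_add]; simp
    rw [← mul_assoc, this]; ring
  · intro t _
    rw [← mul_sub, norm_mul, hexp, one_mul]
    have := hαm t
    rwa [mem_closedBall, dist_eq_norm] at this

/-- The upper transit. -/
lemma upper_arc (hs : SmallPert e μ) {x : ℝ} (hx : 1 / 5 ≤ x) (hx2 : x ≤ 6) :
    ∃ (γ : ℝ → ℂ) (τ y : ℝ), 0 < τ ∧ γ 0 = x + I ∧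
      (∀ t ∈ Icc 0 τ, HasDerivAt γ (pwField e μ 0 (γ t)) t) ∧
      (∀ t ∈ Ioo 0 τ, 1 < (γ t).im) ∧ γ τ = -(y : ℂ) + I ∧ 1 / 20 ≤ y ∧ y ≤ 13 / 2 ∧
      (∀ t ∈ Icc 0 τ, |‖γ t‖ - ‖(x : ℂ) + I‖| ≤ 1 / 1000) := by
  have hpsq : ‖(x : ℂ) + I‖ ^ 2 = x ^ 2 + 1 := by
    rw [← normSq_eq_norm_sq, normSq_apply]; simp; ring
  have hp0 := norm_nonneg ((x : ℂ) + I)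
  have hp : ‖(x : ℂ) + I‖ ≤ 7 := by nlinarith
  have hp1 : 1 ≤ ‖(x : ℂ) + I‖ := by nlinarith
  obtain ⟨γ, h0, hd, hcl⟩ := flow_exists hs (p := x + I) (by linarith)
  have hnorm : ∀ t ∈ Ioo (-1 : ℝ) 4, |‖γ t‖ - ‖(x : ℂ) + I‖| ≤ 1 / 1000 := by
    intro t ht
    have h1 := abs_norm_sub_norm_le (γ t) (Complex.exp (I * t) * (x + I))
    rw [norm_mul, mul_comm I, norm_exp_ofReal_mul_I, one_mul] at h1
    have h2 := hcl t ht
    rw [mul_comm I] at h2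
    exact h1.trans h2
  have hdi : ∀ t ∈ Ioo (-1 : ℝ) 4, HasDerivAt (fun t => (γ t).im) ((pwField e μ 0 (γ t)).im) t :=
    fun t ht => hasDerivAt_im (hd t ht)
  have hn200 : ∀ t ∈ Ioo (-1 : ℝ) 4, ‖γ t‖ ≤ 200 := by
    intro t ht
    have := abs_le.1 (hnorm t ht)
    linarith [this.2]
  have h0m : (0 : ℝ) ∈ Ioo (-1 : ℝ) 4 := by norm_num
  -- initially upward
  have hup : ∀ᶠ s in 𝓝[>] (0 : ℝ), (γ 0).im < (γ s).im := by
    refine right_deriv_pos (hdi 0 h0m).hasDerivWithinAt ?_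
    have := abs_le.1 (field0_im hs (hn200 0 h0m))
    have h3 : (γ 0).re = x := by simp [h0]
    rw [h3] at this
    norm_num at this
    linarith [this.1]
  have him0 : (γ 0).im = 1 := by simp [h0]
  rw [him0] at hup
  obtain ⟨η, hη, hη2⟩ := mem_nhdsGT_iff_exists_Ioo_subset.1 hup
  have hη0 : (0 : ℝ) < η := hη
  -- at time π below
  have hpi3 := Real.pi_gt_three
  have hpi4 := Real.pi_lt_d2
  have hπ : (γ Real.pi).im < 0 := by
    have h1 := hcl Real.pi ⟨by linarith, by linarith⟩
    rw [mul_comm I, exp_pi_mul_I] at h1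
    have h2 := abs_le.1 ((abs_im_le_norm _).trans h1)
    simp at h2
    linarith [h2.2]
  set m := min (η / 2) 1 with hm
  have hm0 : 0 < m := lt_min (by linarith) one_pos
  have hmη : m < η := lt_of_le_of_lt (min_le_left _ _) (by linarith)
  have hm1 : m ≤ 1 := min_le_right _ _
  have hγc : ContinuousOn (fun t => (γ t).im) (Icc m Real.pi) := fun t ht =>
    (hdi t ⟨by linarith [ht.1], by linarith [ht.2]⟩).continuousAt.continuousWithinAt
  have hBcl : IsClosed (Icc m Real.pi ∩ (fun t => (γ t).im) ⁻¹' (Iic 1)) :=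
    hγc.preimage_isClosed_of_isClosed isClosed_Icc isClosed_Iic
  set B := Icc m Real.pi ∩ (fun t => (γ t).im) ⁻¹' (Iic 1) with hB
  have hBne : B.Nonempty := ⟨Real.pi, ⟨by linarith, le_rfl⟩, by simp; linarith⟩
  have hBbd : BddBelow B := ⟨m, fun t ht => ht.1.1⟩
  set τ := sInf B with hτ
  have hτB : τ ∈ B := hBcl.csInf_mem hBne hBbd
  have hτ0 : 0 < τ := lt_of_lt_of_le hm0 hτB.1.1
  have hτπ : τ ≤ Real.pi := hτB.1.2
  have hτI : τ ∈ Ioo (-1 : ℝ) 4 := ⟨by linarith, by linarith⟩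
  have habove : ∀ t ∈ Ioo 0 τ, 1 < (γ t).im := by
    intro t ht
    rcases lt_or_ge t η with h | h
    · exact hη2 ⟨ht.1, h⟩
    · by_contra hc
      push Not at hc
      have : t ∈ B := ⟨⟨by linarith, by linarith [ht.2]⟩, hc⟩
      exact absurd (csInf_le hBbd this) (not_le.2 ht.2)
  have hev : ∀ᶠ s in 𝓝[<] τ, 1 < (γ s).im := by
    filter_upwards [Ioo_mem_nhdsLT hτ0] with s hs
    exact habove s hs
  have hge : 1 ≤ (γ τ).im := by
    refine ge_of_tendsto ((hdi τ hτI).continuousAt.tendsto.mono_left nhdsWithin_le_nhds)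
      (hev.mono fun s hs => hs.le)
  have him : (γ τ).im = 1 := le_antisymm hτB.2 hge
  have hder : (pwField e μ 0 (γ τ)).im ≤ 0 := by
    by_contra hc
    push Not at hc
    obtain ⟨s, hs1, hs2⟩ := ((left_deriv_pos (hdi τ hτI) hc).and hev).exists
    linarith
  have hre : (γ τ).re ≤ 1 / 10 ^ 5 := by
    have := abs_le.1 (field0_im hs (hn200 τ hτI))
    linarith [this.1]
  have hsqτ : ‖γ τ‖ ^ 2 = (γ τ).re ^ 2 + 1 := by
    rw [← normSq_eq_norm_sq, normSq_apply, him]; ring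
  have hnτ := abs_le.1 (hnorm τ hτI)
  have hlow : x ^ 2 - 15 / 1000 ≤ (γ τ).re ^ 2 := by
    nlinarith [hnτ.1, hnτ.2, norm_nonneg (γ τ)]
  have hhigh : (γ τ).re ^ 2 ≤ x ^ 2 + 1 / 50 := by
    nlinarith [hnτ.1, hnτ.2, norm_nonneg (γ τ)]
  refine ⟨γ, τ, -(γ τ).re, hτ0, h0, ?_, habove, ?_, ?_, ?_, ?_⟩
  · intro t ht
    exact hd t ⟨by linarith [ht.1], by linarith [ht.2]⟩
  · apply Complex.ext <;> simp [him]
  · by_contra hc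
    push Not at hc
    nlinarith
  · by_contra hc
    push Not at hc
    nlinarith
  · intro t ht
    exact hnorm t ⟨by linarith [ht.1], by linarith [ht.2]⟩

end upper


section integral
variable {e : ℂ → ℂ} {μ : ℝ} {F : ℂ → ℂ}

/-- `F` is a primitive of the reciprocal of the upper field on a large disc. -/
def IsPrim (e F : ℂ → ℂ) : Prop :=
  ∀ z ∈ ball (60 * I) (119 / 2), HasDerivAt F ((I * z + e z)⁻¹) z

/-- The first integral restricted to the line `Im z = 1`. -/
noncomputable def QQ (F : ℂ → ℂ) (ξ : ℝ) : ℝ := (F ((ξ : ℂ) + I)).im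

lemma sq_norm_sub (z : ℂ) : ‖z - 60 * I‖ ^ 2 = z.re ^ 2 + (z.im - 60) ^ 2 := by
  rw [← normSq_eq_norm_sq, normSq_apply]; simp; ring

lemma sq_norm_eq (z : ℂ) : ‖z‖ ^ 2 = z.re ^ 2 + z.im ^ 2 := by
  rw [← normSq_eq_norm_sq, normSq_apply]; ring

lemma mem_big {z : ℂ} (h1 : 1 ≤ z.im) (h2 : ‖z‖ ≤ 7) : z ∈ ball (60 * I) (119 / 2) := by
  rw [mem_ball, dist_eq_norm]
  have h3 := sq_norm_sub z
  have h4 := sq_norm_eq z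
  have h5 := norm_nonneg z
  have h6 := norm_nonneg (z - 60 * I)
  nlinarith

lemma big_im {z : ℂ} (h : z ∈ ball (60 * I) (119 / 2)) : 1 / 2 < z.im ∧ ‖z‖ ≤ 200 := by
  rw [mem_ball, dist_eq_norm] at h
  constructor
  · have := (abs_le.1 ((abs_im_le_norm (z - 60 * I)))).1
    simp at this
    linarith
  · calc ‖z‖ = ‖(z - 60 * I) + 60 * I‖ := by ring_nf
      _ ≤ ‖z - 60 * I‖ + ‖60 * I‖ := norm_add_le _ _
      _ ≤ 200 := by simp; linarith

lemma big_ne (hs : SmallPert e μ) {z : ℂ} (h : z ∈ ball (60 * I) (119 / 2)) :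
    I * z + e z ≠ 0 := by
  obtain ⟨h1, h2⟩ := big_im h
  intro h0
  have h3 := hs.bd z h2
  have h4 : e z = - (I * z) := by linear_combination h0
  rw [h4, norm_neg, norm_mul, norm_I, one_mul] at h3
  have := (abs_le.1 (abs_im_le_norm z)).2
  norm_num at h3
  linarith

lemma prim_exists (hs : SmallPert e μ) : ∃ F, IsPrim e F := by
  have hd : DifferentiableOn ℂ (fun z => (I * z + e z)⁻¹) (ball (60 * I) (119 / 2)) := by
    intro z hz
    have h1 : DifferentiableAt ℂ (fun z => I * z + e z) z := by
      have := hs.diff z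
      fun_prop
    exact (h1.inv (big_ne hs hz)).differentiableWithinAt
  obtain ⟨g, hg⟩ := hd.isExactOn_ball
  exact ⟨g, hg⟩

lemma line_mem {ξ : ℝ} (h1 : -69 / 10 ≤ ξ) (h2 : ξ ≤ 69 / 10) :
    (ξ : ℂ) + I ∈ ball (60 * I) (119 / 2) := by
  refine mem_big (by simp) ?_
  have := sq_norm_eq ((ξ : ℂ) + I)
  simp at this
  have h5 := norm_nonneg ((ξ : ℂ) + I)
  nlinarith

lemma QQ_deriv (hF : IsPrim e F) {ξ : ℝ} (h1 : -69 / 10 ≤ ξ) (h2 : ξ ≤ 69 / 10) :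
    HasDerivAt (QQ F) ((I * ((ξ : ℂ) + I) + e ((ξ : ℂ) + I))⁻¹).im ξ := by
  have h := hF _ (line_mem h1 h2)
  have h3 : HasDerivAt (fun ξ : ℝ => (ξ : ℂ) + I) 1 ξ :=
    (Complex.ofRealCLM.hasDerivAt (x := ξ)).add_const I
  have h4 := HasDerivAt.comp (𝕜 := ℝ) (𝕜' := ℂ) ξ h h3
  rw [mul_one] at h4
  exact hasDerivAt_im h4

lemma QQ_deriv_sign (hs : SmallPert e μ) {ξ : ℝ} (h1 : -69 / 10 ≤ ξ) (h2 : ξ ≤ 69 / 10) :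
    ((1 / 100 < ξ) → ((I * ((ξ : ℂ) + I) + e ((ξ : ℂ) + I))⁻¹).im < 0) ∧
    ((ξ < -(1 / 100)) → 0 < ((I * ((ξ : ℂ) + I) + e ((ξ : ℂ) + I))⁻¹).im) := by
  have hm := line_mem h1 h2
  have hne := big_ne hs hm
  have h3 := field0_im hs (big_im hm).2
  rw [pwField0] at h3
  rw [inv_im]
  have hpos := normSq_pos.2 hne
  rw [abs_le] at h3
  have hre : ((ξ : ℂ) + I).re = ξ := by simp
  rw [hre] at h3
  constructor
  · intro h
    apply div_neg_of_neg_of_pos _ hpos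
    linarith [h3.1]
  · intro h
    apply div_pos _ hpos
    linarith [h3.2]

lemma QQ_anti (hs : SmallPert e μ) (hF : IsPrim e F) :
    StrictAntiOn (QQ F) (Icc (1 / 100) (69 / 10)) := by
  refine strictAntiOn_of_deriv_neg (convex_Icc _ _) ?_ ?_
  · intro ξ hξ
    exact (QQ_deriv hF (by linarith [hξ.1]) hξ.2).continuousAt.continuousWithinAt
  · intro ξ hξ
    rw [interior_Icc] at hξ
    rw [(QQ_deriv hF (by linarith [hξ.1]) hξ.2.le).deriv]
    exact (QQ_deriv_sign hs (by linarith [hξ.1]) hξ.2.le).1 hξ.1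

lemma QQ_mono (hs : SmallPert e μ) (hF : IsPrim e F) :
    StrictMonoOn (QQ F) (Icc (-(69 / 10)) (-(1 / 100))) := by
  refine strictMonoOn_of_deriv_pos (convex_Icc _ _) ?_ ?_
  · intro ξ hξ
    exact (QQ_deriv hF (by linarith [hξ.1]) (by linarith [hξ.2])).continuousAt.continuousWithinAt
  · intro ξ hξ
    rw [interior_Icc] at hξ
    rw [(QQ_deriv hF (by linarith [hξ.1]) (by linarith [hξ.2])).deriv]
    exact (QQ_deriv_sign hs (by linarith [hξ.1]) (by linarith [hξ.2])).2 hξ.2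

lemma arc_integral (hs : SmallPert e μ) (hF : IsPrim e F) {γ : ℝ → ℂ} {τ : ℝ} (hτ : 0 ≤ τ)
    (hγ : ∀ t ∈ Icc 0 τ, HasDerivAt γ (pwField e μ 0 (γ t)) t)
    (him : ∀ t ∈ Icc 0 τ, 1 ≤ (γ t).im) (hn : ∀ t ∈ Icc 0 τ, ‖γ t‖ ≤ 7) :
    (F (γ τ)).im = (F (γ 0)).im := by
  have hd : ∀ t ∈ Icc 0 τ, HasDerivAt (fun t => (F (γ t)).im) 0 t := by
    intro t ht
    have hm := mem_big (him t ht) (hn t ht)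
    have h4 := HasDerivAt.comp (𝕜 := ℝ) (𝕜' := ℂ) t (hF _ hm) (hγ t ht)
    rw [pwField0, inv_mul_cancel₀ (big_ne hs hm)] at h4
    simpa using hasDerivAt_im h4
  refine constant_of_has_deriv_right_zero (f := fun t => (F (γ t)).im) (a := 0) (b := τ)
    (fun t ht => (hd t ht).continuousAt.continuousWithinAt)
    (fun t ht => (hd t (Ico_subset_Icc_self ht)).hasDerivWithinAt) τ ⟨hτ, le_rfl⟩

/-- The upper transit together with the first integral. -/
lemma upper_full (hs : SmallPert e μ) (hF : IsPrim e F) {x : ℝ} (hx : 1 / 5 ≤ x) (hx2 : x ≤ 6) :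
    ∃ (γ : ℝ → ℂ) (τ y : ℝ), 0 < τ ∧ γ 0 = x + I ∧
      (∀ t ∈ Icc 0 τ, HasDerivAt γ (pwField e μ 0 (γ t)) t) ∧
      (∀ t ∈ Ioo 0 τ, 1 < (γ t).im) ∧ γ τ = -(y : ℂ) + I ∧ 1 / 20 ≤ y ∧ y ≤ 13 / 2 ∧
      (∀ t ∈ Icc 0 τ, |‖γ t‖ - ‖(x : ℂ) + I‖| ≤ 1 / 1000) ∧ QQ F x = QQ F (-y) := by
  obtain ⟨γ, τ, y, h1, h2, h3, h4, h5, h6, h7, h8⟩ := upper_arc hs hx hx2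
  refine ⟨γ, τ, y, h1, h2, h3, h4, h5, h6, h7, h8, ?_⟩
  have := arc_integral hs hF h1.le h3 ?_ ?_
  · rw [h5, h2] at this
    simp only [QQ]
    push_cast
    exact this.symm
  · intro t ht
    rcases eq_or_lt_of_le ht.1 with h | h
    · rw [← h, h2]; simp
    rcases eq_or_lt_of_le ht.2 with h' | h'
    · rw [h', h5]; simp
    · exact (h4 t ⟨h, h'⟩).le
  · intro t ht
    have h9 := (abs_le.1 (h8 t ht)).2
    have h10 := sq_norm_eq ((x : ℂ) + I)
    simp at h10
    nlinarith [norm_nonneg ((x : ℂ) + I)]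

end integral


section lower
variable {e : ℂ → ℂ} {μ : ℝ} {F : ℂ → ℂ}

/-- Exit-side potential of the lower spiral. -/
noncomputable def NN (μ x : ℝ) : ℝ := Real.log (1 + x ^ 2) / 2 + μ * Real.arctan x

lemma NN_deriv (μ x : ℝ) : HasDerivAt (NN μ) ((x + μ) / (1 + x ^ 2)) x := by
  have hpos : (0 : ℝ) < 1 + x ^ 2 := by positivity
  have h1 : HasDerivAt (fun x : ℝ => 1 + x ^ 2) (2 * x) x := by
    simpa using (hasDerivAt_pow 2 x).const_add 1
  have h2 := (h1.log hpos.ne').div_const 2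
  have h3 := (Real.hasDerivAt_arctan x).const_mul μ
  have h4 := h2.add h3
  refine HasDerivAt.congr_deriv h4 ?_
  field_simp

lemma NN_slope (hμ : |μ| ≤ 1 / 10 ^ 5) {x : ℝ} (h1 : 1 / 5 ≤ x) (h2 : x ≤ 5) :
    3 / 20 ≤ (x + μ) / (1 + x ^ 2) := by
  rw [abs_le] at hμ
  rw [le_div_iff₀ (by positivity)]
  norm_num at hμ
  nlinarith

lemma NN_growth (hμ : |μ| ≤ 1 / 10 ^ 5) {a b : ℝ} (ha : a ∈ Icc (1 / 5 : ℝ) 5)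
    (hb : b ∈ Icc (1 / 5 : ℝ) 5) (hab : a ≤ b) : 3 / 20 * (b - a) ≤ NN μ b - NN μ a := by
  refine (convex_Icc (1 / 5 : ℝ) 5).mul_sub_le_image_sub_of_le_deriv ?_ ?_ ?_ a ha b hb hab
  · intro x _
    exact (NN_deriv μ x).continuousAt.continuousWithinAt
  · intro x _
    exact (NN_deriv μ x).differentiableAt.differentiableWithinAt
  · intro x hx
    rw [interior_Icc] at hx
    rw [(NN_deriv μ x).deriv]
    exact NN_slope hμ hx.1.le hx.2.le

lemma NN_mono (hμ : |μ| ≤ 1 / 10 ^ 5) : StrictMonoOn (NN μ) (Icc (1 / 5 : ℝ) 5) := by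
  intro a ha b hb hab
  have := NN_growth hμ ha hb hab.le
  nlinarith

/-- Specification of the half-return map of the lower spiral. -/
def IsX (μ : ℝ) (X : ℝ → ℝ) : Prop :=
  ∀ y ∈ Icc (6 / 25 : ℝ) (9 / 2), |X y - y| ≤ 100 * |μ| ∧ NN μ (X y) = NN (-μ) y + 2 * Real.pi * μ

lemma X_exists (hμ : |μ| ≤ 1 / 10 ^ 5) : ∃ X, IsX μ X := by
  have key : ∀ y ∈ Icc (6 / 25 : ℝ) (9 / 2),
      ∃ x, |x - y| ≤ 100 * |μ| ∧ NN μ x = NN (-μ) y + 2 * Real.pi * μ := by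
    intro y hy
    have h0 := abs_nonneg μ
    have hμ' : 100 * |μ| ≤ 1 / 1000 := by norm_num at hμ ⊢; linarith
    have hyI : y ∈ Icc (1 / 5 : ℝ) 5 := ⟨by linarith [hy.1], by linarith [hy.2]⟩
    have ha : y - 100 * |μ| ∈ Icc (1 / 5 : ℝ) 5 := ⟨by linarith [hy.1], by linarith [hy.2]⟩
    have hb : y + 100 * |μ| ∈ Icc (1 / 5 : ℝ) 5 := ⟨by linarith [hy.1], by linarith [hy.2]⟩
    have g1 := NN_growth hμ ha hyI (by linarith)
    have g2 := NN_growth hμ hyI hb (by linarith)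
    have hdiff : |NN (-μ) y + 2 * Real.pi * μ - NN μ y| ≤ 14 * |μ| := by
      have : NN (-μ) y + 2 * Real.pi * μ - NN μ y = μ * (2 * Real.pi - 2 * Real.arctan y) := by
        simp only [NN]; ring
      rw [this, abs_mul, mul_comm]
      refine mul_le_mul_of_nonneg_right ?_ h0
      have p1 := Real.arctan_lt_pi_div_two y
      have p2 := Real.neg_pi_div_two_lt_arctan y
      have p3 := Real.pi_lt_d2
      rw [abs_le]; constructor <;> linarith
    rw [abs_le] at hdiff
    have hc : ContinuousOn (NN μ) (Icc (y - 100 * |μ|) (y + 100 * |μ|)) := fun x _ =>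
      (NN_deriv μ x).continuousAt.continuousWithinAt
    obtain ⟨x, hx, hx2⟩ := intermediate_value_Icc (by linarith) hc
      (show NN (-μ) y + 2 * Real.pi * μ ∈ _ from ⟨by linarith, by linarith⟩)
    exact ⟨x, abs_le.2 ⟨by linarith [hx.1], by linarith [hx.2]⟩, hx2⟩
  choose! X hX using key
  exact ⟨X, hX⟩

lemma X_mem (hμ : |μ| ≤ 1 / 10 ^ 5) {X : ℝ → ℝ} (hX : IsX μ X) {y : ℝ}
    (hy : y ∈ Icc (6 / 25 : ℝ) (9 / 2)) : X y ∈ Icc (23 / 100 : ℝ) (23 / 5) := by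
  have := (hX y hy).1
  have hμ' : 100 * |μ| ≤ 1 / 1000 := by norm_num at hμ ⊢; linarith
  rw [abs_le] at this
  exact ⟨by linarith [hy.1], by linarith [hy.2]⟩

lemma X_mono (hμ : |μ| ≤ 1 / 10 ^ 5) {X : ℝ → ℝ} (hX : IsX μ X) :
    StrictMonoOn X (Icc (6 / 25 : ℝ) (9 / 2)) := by
  intro a ha b hb hab
  have h1 := NN_mono (μ := -μ) (by rwa [abs_neg]) (a := a) (b := b)
    ⟨by linarith [ha.1], by linarith [ha.2]⟩ ⟨by linarith [hb.1], by linarith [hb.2]⟩ hab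
  have ha' := X_mem hμ hX ha
  have hb' := X_mem hμ hX hb
  by_contra hc
  push Not at hc
  have h2 := (NN_mono hμ).monotoneOn
    (show X b ∈ Icc (1 / 5 : ℝ) 5 from ⟨by linarith [hb'.1], by linarith [hb'.2]⟩)
    (show X a ∈ Icc (1 / 5 : ℝ) 5 from ⟨by linarith [ha'.1], by linarith [ha'.2]⟩) hc
  rw [(hX a ha).2, (hX b hb).2] at h2
  linarith

lemma NN_analytic (μ x : ℝ) : AnalyticAt ℝ (NN μ) x := by
  have h1 : AnalyticAt ℝ (fun x : ℝ => Real.log (1 + x ^ 2)) x := by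
    refine AnalyticAt.log (by fun_prop) (by positivity)
  have h2 : AnalyticAt ℝ Real.arctan x := (Real.contDiff_arctan.contDiffAt).analyticAt
  unfold NN
  exact (h1.div analyticAt_const (by norm_num)).add (analyticAt_const.mul h2)

lemma X_analytic (hμ : |μ| ≤ 1 / 10 ^ 5) {X : ℝ → ℝ} (hX : IsX μ X) {y : ℝ}
    (hy : y ∈ Ioo (6 / 25 : ℝ) (9 / 2)) : AnalyticAt ℝ X y := by
  have hyc := Ioo_subset_Icc_self hy
  have hXm := X_mem hμ hX hyc
  have hN := NN_analytic μ (X y)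
  have hd : deriv (NN μ) (X y) ≠ 0 := by
    rw [(NN_deriv μ _).deriv]
    have := NN_slope hμ (x := X y) (by linarith [hXm.1]) (by linarith [hXm.2])
    linarith
  set L := hN.hasStrictDerivAt.localInverse _ _ _ hd with hL
  have hLa : AnalyticAt ℝ L (NN μ (X y)) := hN.analyticAt_localInverse hd
  have hL0 : L (NN μ (X y)) = X y := HasStrictFDerivAt.localInverse_apply_image ..
  have hLr : ∀ᶠ q in 𝓝 (NN μ (X y)), NN μ (L q) = q :=
    HasStrictDerivAt.eventually_right_inverse ..
  set G : ℝ → ℝ := fun y => NN (-μ) y + 2 * Real.pi * μ with hG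
  have hGa : AnalyticAt ℝ G y := (NN_analytic (-μ) y).add analyticAt_const
  have hGy : NN μ (X y) = G y := (hX y hyc).2
  rw [hGy] at hLa hLr hL0
  have hcomp : AnalyticAt ℝ (L ∘ G) y := hLa.comp hGa
  refine hcomp.congr ?_
  have e1 : ∀ᶠ y' in 𝓝 y, NN μ (L (G y')) = G y' := hGa.continuousAt.tendsto.eventually hLr
  have e2 : ∀ᶠ y' in 𝓝 y, L (G y') ∈ Icc (1 / 5 : ℝ) 5 := by
    have : ContinuousAt (L ∘ G) y := hcomp.continuousAt
    refine this.tendsto.eventually (Icc_mem_nhds ?_ ?_)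
    · simp only [Function.comp, hL0]; linarith [hXm.1]
    · simp only [Function.comp, hL0]; linarith [hXm.2]
  have e3 : ∀ᶠ y' in 𝓝 y, y' ∈ Icc (6 / 25 : ℝ) (9 / 2) := Icc_mem_nhds hy.1 hy.2
  filter_upwards [e1, e2, e3] with y' h1 h2 h3
  have h4 := X_mem hμ hX h3
  refine (NN_mono hμ).injOn h2 ⟨by linarith [h4.1], by linarith [h4.2]⟩ ?_
  rw [h1, (hX y' h3).2]

/-- Displacement function. -/
noncomputable def DD (F : ℂ → ℂ) (X : ℝ → ℝ) (y : ℝ) : ℝ := QQ F (X y) - QQ F (-y)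

lemma QQ_analytic (hF : IsPrim e F) {ξ : ℝ} (h1 : -69 / 10 < ξ) (h2 : ξ < 69 / 10) :
    AnalyticAt ℝ (QQ F) ξ := by
  have hFa : AnalyticAt ℂ F ((ξ : ℂ) + I) := by
    have hd : DifferentiableOn ℂ F (ball (60 * I) (119 / 2)) := fun z hz =>
      (hF z hz).differentiableAt.differentiableWithinAt
    exact hd.analyticAt (isOpen_ball.mem_nhds (line_mem h1.le h2.le))
  have hFr : AnalyticAt ℝ F ((ξ : ℂ) + I) := hFa.restrictScalars
  have hl : AnalyticAt ℝ (fun ξ : ℝ => (ξ : ℂ) + I) ξ :=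
    (Complex.ofRealCLM.analyticAt ξ).add analyticAt_const
  have h3 : AnalyticAt ℝ (fun ξ : ℝ => F ((ξ : ℂ) + I)) ξ :=
    AnalyticAt.comp' (f := fun ξ : ℝ => (ξ : ℂ) + I) (g := F) hFr hl
  exact (imCLM.analyticAt _).comp h3

lemma DD_analytic (hμ : |μ| ≤ 1 / 10 ^ 5) (hF : IsPrim e F) {X : ℝ → ℝ} (hX : IsX μ X) {y : ℝ}
    (hy : y ∈ Ioo (6 / 25 : ℝ) (9 / 2)) : AnalyticAt ℝ (DD F X) y := by
  have hXm := X_mem hμ hX (Ioo_subset_Icc_self hy)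
  have h1 : AnalyticAt ℝ (fun y => QQ F (X y)) y :=
    (QQ_analytic hF (by linarith [hXm.1]) (by linarith [hXm.2])).comp' (X_analytic hμ hX hy)
  have h2 : AnalyticAt ℝ (fun y => QQ F (-y)) y :=
    AnalyticAt.comp' (f := fun y : ℝ => -y) (g := QQ F)
      (QQ_analytic hF (by linarith [hy.2]) (by linarith [hy.1])) analyticAt_id.neg
  exact h1.sub h2

/-- The lower spiral. -/
noncomputable def spir (μ y s : ℝ) : ℂ := Complex.exp ((I + μ) * s) * (-(y : ℂ) + I)

lemma polar (x : ℝ) : (x : ℂ) + I =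
    Complex.exp (((Real.log (1 + x ^ 2) / 2 : ℝ) : ℂ) + ((Real.pi / 2 - Real.arctan x : ℝ) : ℂ) * I)
    := by
  have hpos : (0 : ℝ) < 1 + x ^ 2 := by positivity
  have hsq : Real.exp (Real.log (1 + x ^ 2) / 2) = √(1 + x ^ 2) := by
    rw [Real.exp_half, Real.exp_log hpos]
  have hs0 : √(1 + x ^ 2) ≠ 0 := (Real.sqrt_pos.2 hpos).ne'
  apply Complex.ext
  · rw [exp_re]
    simp [-ofReal_div, -ofReal_sub, hsq, Real.cos_pi_div_two_sub, Real.sin_arctan]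
    field_simp
  · rw [exp_im]
    simp [-ofReal_div, -ofReal_sub, hsq, Real.sin_pi_div_two_sub, Real.cos_arctan]
    field_simp

lemma spir_zero (μ y : ℝ) : spir μ y 0 = -(y : ℂ) + I := by simp [spir]

lemma spir_deriv (e : ℂ → ℂ) (μ y s : ℝ) : HasDerivAt (spir μ y) (pwField e μ 1 (spir μ y s)) s := by
  have h1 : HasDerivAt (fun s : ℝ => (I + (μ : ℂ)) * (s : ℂ)) ((I + μ) * 1) s :=
    (Complex.ofRealCLM.hasDerivAt (x := s)).const_mul (I + (μ : ℂ))
  have h2 := h1.cexp.mul_const (-(y : ℂ) + I)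
  refine HasDerivAt.congr_deriv h2 ?_
  rw [pwField1, spir]; ring

lemma spir_polar (μ y s : ℝ) : spir μ y s =
    Complex.exp (((Real.log (1 + y ^ 2) / 2 + μ * s : ℝ) : ℂ) +
      ((Real.pi / 2 + Real.arctan y + s : ℝ) : ℂ) * I) := by
  have := polar (-y)
  rw [Real.arctan_neg, neg_sq] at this
  push_cast at this
  rw [spir, this, ← Complex.exp_add]
  congr 1
  push_cast
  ring

lemma spir_im (μ y s : ℝ) : (spir μ y s).im =
    Real.exp (Real.log (1 + y ^ 2) / 2 + μ * s) * Real.cos (Real.arctan y + s) := by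
  rw [spir_polar, exp_im]
  simp only [add_re, ofReal_re, mul_re, I_re, ofReal_im, I_im, add_im, mul_im]
  simp only [mul_zero, zero_mul, sub_zero, add_zero, mul_one, zero_add]
  rw [add_assoc, add_comm (Real.pi / 2), Real.sin_add_pi_div_two]

lemma spir_end {y x : ℝ} (h : NN μ x = NN (-μ) y + 2 * Real.pi * μ) :
    spir μ y (2 * Real.pi - Real.arctan x - Real.arctan y) = x + I := by
  rw [spir_polar, polar x, Complex.exp_eq_exp_iff_exists_int]
  refine ⟨1, ?_⟩
  have h2 : Real.log (1 + y ^ 2) / 2 + μ * (2 * Real.pi - Real.arctan x - Real.arctan y)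
      = Real.log (1 + x ^ 2) / 2 := by
    simp only [NN] at h; linear_combination -h
  rw [h2]
  push_cast
  ring

lemma damp_lt {k μ α θ : ℝ} (h0 : 0 < α) (hα : |μ| < Real.sin α)
    (h1 : Real.exp (k + μ * α) * Real.cos α = 1) (hθ : α < θ) (hθ2 : θ ≤ Real.pi / 2) :
    Real.exp (k + μ * θ) * Real.cos θ < 1 := by
  rw [← h1]
  have hd : ∀ t, HasDerivAt (fun t => Real.exp (k + μ * t) * Real.cos t)
      (Real.exp (k + μ * t) * (μ * Real.cos t - Real.sin t)) t := by
    intro t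
    have h2 : HasDerivAt (fun t : ℝ => k + μ * t) μ t := by
      simpa using ((hasDerivAt_id t).const_mul μ).const_add k
    refine HasDerivAt.congr_deriv (h2.exp.mul (Real.hasDerivAt_cos t)) ?_
    ring
  have hanti : StrictAntiOn (fun t => Real.exp (k + μ * t) * Real.cos t)
      (Icc α (Real.pi / 2)) := by
    refine strictAntiOn_of_deriv_neg (convex_Icc _ _)
      (fun t _ => (hd t).continuousAt.continuousWithinAt) ?_
    intro t ht
    rw [interior_Icc] at ht
    rw [(hd t).deriv]
    refine mul_neg_of_pos_of_neg (Real.exp_pos _) ?_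
    have hs : Real.sin α < Real.sin t :=
      Real.strictMonoOn_sin ⟨by linarith, by linarith [ht.1, ht.2]⟩ ⟨by linarith [ht.1], ht.2.le⟩ ht.1
    have hc : |μ * Real.cos t| ≤ |μ| := by
      rw [abs_mul]
      exact mul_le_of_le_one_right (abs_nonneg _) (Real.abs_cos_le_one t)
    linarith [le_abs_self (μ * Real.cos t)]
  exact hanti ⟨le_rfl, by linarith⟩ ⟨hθ.le, hθ2⟩ hθ

lemma sin_arctan_big (hμ : |μ| ≤ 1 / 10 ^ 5) {y : ℝ} (h : 1 / 5 ≤ y) :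
    |μ| < Real.sin (Real.arctan y) := by
  rw [Real.sin_arctan]
  refine lt_of_le_of_lt hμ ?_
  rw [lt_div_iff₀ (Real.sqrt_pos.2 (by positivity))]
  have : √(1 + y ^ 2) ≤ 1 + y := by
    rw [Real.sqrt_le_left (by linarith)]; nlinarith
  norm_num
  linarith

lemma spir_lt (hμ : |μ| ≤ 1 / 10 ^ 5) {y x s : ℝ} (hy : 1 / 5 ≤ y) (hx : 1 / 5 ≤ x)
    (h : NN μ x = NN (-μ) y + 2 * Real.pi * μ)
    (hs : s ∈ Ioo 0 (2 * Real.pi - Real.arctan x - Real.arctan y)) : (spir μ y s).im < 1 := by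
  have hend := spir_end h
  have a1 : 0 < Real.arctan y := Real.arctan_pos.2 (by linarith)
  have a2 : 0 < Real.arctan x := Real.arctan_pos.2 (by linarith)
  set L := Real.log (1 + y ^ 2) / 2 with hL
  set α := Real.arctan y with hα
  set β := Real.arctan x with hβ
  have e0 : (spir μ y 0).im = 1 := by simp [spir_zero]
  have e1 : (spir μ y (2 * Real.pi - β - α)).im = 1 := by simp [hend]
  rw [spir_im] at e0 e1 ⊢
  rw [← hL, ← hα] at *
  rcases le_or_gt (α + s) (Real.pi / 2) with h1 | h1
  · have := damp_lt (k := L - μ * α) (μ := μ) (α := α) (θ := α + s) a1 (sin_arctan_big hμ hy)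
      (by rw [← e0]; congr 2 <;> ring_nf) (by linarith [hs.1]) h1
    rw [show L - μ * α + μ * (α + s) = L + μ * s by ring] at this
    exact this
  rcases le_or_gt (α + s) (3 * Real.pi / 2) with h2 | h2
  · have : Real.cos (α + s) ≤ 0 :=
      Real.cos_nonpos_of_pi_div_two_le_of_le h1.le (by linarith)
    have h3 := mul_nonpos_of_nonneg_of_nonpos (Real.exp_pos (L + μ * s)).le this
    linarith
  · have hcos : ∀ θ, Real.cos (2 * Real.pi - θ) = Real.cos θ := Real.cos_two_pi_sub
    have := damp_lt (k := L - μ * α + μ * (2 * Real.pi)) (μ := -μ) (α := β)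
      (θ := 2 * Real.pi - (α + s)) a2
      (by rw [abs_neg]; exact sin_arctan_big hμ hx)
      (by rw [← e1, ← hcos β]; congr 2 <;> ring_nf) (by linarith [hs.2]) (by linarith)
    rw [hcos] at this
    rw [show L - μ * α + μ * (2 * Real.pi) + -μ * (2 * Real.pi - (α + s)) = L + μ * s by ring] at this
    exact this

lemma spir_norm (μ y s : ℝ) : ‖spir μ y s‖ = Real.exp (μ * s) * ‖-(y : ℂ) + I‖ := by
  rw [spir, norm_mul, norm_exp]
  simp

lemma spir_norm_bd (hμ : |μ| ≤ 1 / 10 ^ 5) {y s : ℝ} (hy : y ∈ Icc (6 / 25 : ℝ) (9 / 2))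
    (hs : s ∈ Icc (0 : ℝ) 10) : 102 / 100 < ‖spir μ y s‖ ∧ ‖spir μ y s‖ < 5 := by
  rw [spir_norm]
  have h1 := sq_norm_eq (-(y : ℂ) + I)
  simp at h1
  have h2 := norm_nonneg (-(y : ℂ) + I)
  have h3 : |μ * s| ≤ 1 / 10 ^ 4 := by
    rw [abs_mul, abs_of_nonneg hs.1]
    norm_num at hμ ⊢
    nlinarith [hs.1, hs.2, abs_nonneg μ]
  rw [abs_le] at h3
  have h4 := Real.add_one_le_exp (μ * s)
  have h5 := Real.add_one_le_exp (-(μ * s))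
  have h6 : Real.exp (μ * s) * Real.exp (-(μ * s)) = 1 := by rw [← Real.exp_add]; simp
  have h7 := Real.exp_pos (μ * s)
  norm_num at h3
  have h8 : Real.exp (μ * s) ≤ 1001 / 1000 := by nlinarith
  have h9 : 999 / 1000 ≤ Real.exp (μ * s) := by linarith [h3.1]
  have h10 : 1028 / 1000 ≤ ‖-(y : ℂ) + I‖ := by nlinarith [hy.1]
  have h11 : ‖-(y : ℂ) + I‖ ≤ 4.7 := by nlinarith [hy.1, hy.2]
  constructor <;> nlinarith

end lower


section lap
variable {e : ℂ → ℂ} {μ : ℝ} {F : ℂ → ℂ}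

/-- One turn: lower spiral from `-y + i` to `x + i`, then upper arc to `-y1 + i`. -/
structure Lap (e : ℂ → ℂ) (μ y x y1 S τ : ℝ) (γ : ℝ → ℂ) : Prop where
  hy : y ∈ Icc (6 / 25 : ℝ) (9 / 2)
  hx : x ∈ Icc (1 / 5 : ℝ) 5
  hS : 0 < S
  hS2 : S ≤ 10
  hτ : 0 < τ
  send : spir μ y S = (x : ℂ) + I
  slt : ∀ s ∈ Ioo 0 S, (spir μ y s).im < 1
  g0 : γ 0 = (x : ℂ) + I
  gd : ∀ t ∈ Icc 0 τ, HasDerivAt γ (pwField e μ 0 (γ t)) t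
  ggt : ∀ t ∈ Ioo 0 τ, 1 < (γ t).im
  gend : γ τ = -(y1 : ℂ) + I
  gn : ∀ t ∈ Icc 0 τ, 101 / 100 < ‖γ t‖ ∧ ‖γ t‖ < 7

lemma lap_exists (hs : SmallPert e μ) (hF : IsPrim e F) {X : ℝ → ℝ} (hX : IsX μ X) {y : ℝ}
    (hy : y ∈ Icc (6 / 25 : ℝ) (9 / 2)) :
    ∃ y1 S τ γ, Lap e μ y (X y) y1 S τ γ ∧ 1 / 20 ≤ y1 ∧ y1 ≤ 13 / 2 ∧
      QQ F (X y) = QQ F (-y1) := by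
  have hXm := X_mem hs.mu hX hy
  obtain ⟨γ, τ, y1, h1, h2, h3, h4, h5, h6, h7, h8, h9⟩ :=
    upper_full hs hF (x := X y) (by linarith [hXm.1]) (by linarith [hXm.2])
  have hN := (hX y hy).2
  have a1 := Real.arctan_lt_pi_div_two y
  have a2 := Real.arctan_lt_pi_div_two (X y)
  have a3 : 0 < Real.arctan y := Real.arctan_pos.2 (by linarith [hy.1])
  have a4 : 0 < Real.arctan (X y) := Real.arctan_pos.2 (by linarith [hXm.1])
  have a5 := Real.pi_lt_d2
  have a6 := Real.pi_gt_three
  refine ⟨y1, 2 * Real.pi - Real.arctan (X y) - Real.arctan y, τ, γ,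
    ⟨hy, ⟨by linarith [hXm.1], by linarith [hXm.2]⟩, by linarith, by linarith, h1, spir_end hN,
      fun s hs' => spir_lt hs.mu (by linarith [hy.1]) (by linarith [hXm.1]) hN hs', h2, h3, h4, h5,
      fun t ht => ?_⟩,
    h6, h7, h9⟩
  have b1 := abs_le.1 (h8 t ht)
  have b2 := sq_norm_eq ((X y : ℂ) + I)
  simp at b2
  have b3 := norm_nonneg ((X y : ℂ) + I)
  have b4 : 1025 / 1000 ≤ ‖(X y : ℂ) + I‖ := by nlinarith [hXm.1]
  have b5 : ‖(X y : ℂ) + I‖ ≤ 6 := by nlinarith [hXm.1, hXm.2]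
  constructor <;> linarith [b1.1, b1.2]

lemma lap_follow (hs : SmallPert e μ) {w : ℝ → ℂ}
    (hw : IsCrossingPeriodicOrbit zonesLines (pwField e μ) curvesLines w)
    {y x y1 S τ : ℝ} {γ : ℝ → ℂ} (L : Lap e μ y x y1 S τ γ) {t0 : ℝ}
    (h0 : w t0 = -(y : ℂ) + I) :
    (∀ s ∈ Icc 0 S, w (t0 + s) = spir μ y s) ∧ (∀ s ∈ Icc 0 τ, w (t0 + S + s) = γ s) := by
  have hw0 := orbit_continuous hw
  have h1 : ∀ s ∈ Icc 0 S, w (t0 + s) = spir μ y s := by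
    refine follow (V := {z : ℂ | z.im < 1}) (isOpen_Iio.preimage continuous_im) hw0
      (pwField_cont hs.diff 1) (orbit_lower hw) (fun s _ => spir_deriv e μ y s) L.slt
      (by rw [h0, spir_zero]) ?_
    exact orbit_enter_lower hs hw (by linarith [L.hy.1]) (by linarith [L.hy.2]) h0
  refine ⟨h1, ?_⟩
  have h2 : w (t0 + S) = (x : ℂ) + I := by rw [h1 S ⟨L.hS.le, le_rfl⟩, L.send]
  refine follow (V := {z : ℂ | 1 < z.im}) (isOpen_Ioi.preimage continuous_im) hw0
    (pwField_cont hs.diff 0) (orbit_upper hw) L.gd L.ggt (by rw [h2, L.g0]) ?_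
  exact orbit_enter_upper hs hw (by linarith [L.hx.1]) h2

/-- `Z` is the periodic curve obtained from a closed lap. -/
structure Closed (μ y S τ : ℝ) (γ Z : ℝ → ℂ) : Prop where
  cont : Continuous Z
  per : Function.Periodic Z (S + τ)
  low : ∀ s ∈ Icc 0 S, Z s = spir μ y s
  up : ∀ s ∈ Icc 0 τ, Z (S + s) = γ s

lemma closed_exists {y x S τ : ℝ} {γ : ℝ → ℂ} (L : Lap e μ y x y S τ γ) :
    ∃ Z, Closed μ y S τ γ Z := by
  have hS := L.hS
  have hτ := L.hτ
  have : Fact (0 < S + τ) := ⟨by linarith⟩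
  set c : ℝ → ℂ := fun s => if s ≤ S then spir μ y s else γ (s - S) with hc
  have c0 : c 0 = -(y : ℂ) + I := by simp only [hc]; rw [if_pos hS.le, spir_zero]
  have c1 : c (S + τ) = -(y : ℂ) + I := by
    simp only [hc]; rw [if_neg (by linarith)]; rw [add_sub_cancel_left, L.gend]
  have hspc : Continuous (spir μ y) :=
    continuous_iff_continuousAt.2 fun s => (spir_deriv e μ y s).continuousAt
  have hcc : ContinuousOn c (Icc 0 (S + τ)) := by
    have e1 : Icc 0 (S + τ) = Icc 0 S ∪ Icc S (S + τ) := by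
      rw [Icc_union_Icc_eq_Icc hS.le (by linarith)]
    rw [e1]
    refine ContinuousOn.union_of_isClosed ?_ ?_ isClosed_Icc isClosed_Icc
    · refine hspc.continuousOn.congr ?_
      intro s hs; simp only [hc]; rw [if_pos hs.2]
    · have : ContinuousOn (fun s => γ (s - S)) (Icc S (S + τ)) := by
        have h2 : ContinuousOn γ (Icc 0 τ) := fun t ht =>
          (L.gd t ht).continuousAt.continuousWithinAt
        refine h2.comp (by fun_prop) ?_
        intro s hs; exact ⟨by linarith [hs.1], by linarith [hs.2]⟩
      refine this.congr ?_
      intro s hs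
      simp only [hc]
      split_ifs with h
      · have : s = S := le_antisymm h hs.1
        rw [this, sub_self, L.g0, L.send]
      · rfl
  set Z : ℝ → ℂ := fun t => AddCircle.liftIco (S + τ) 0 c (t : AddCircle (S + τ)) with hZ
  have hper : Function.Periodic Z (S + τ) := by
    intro t; simp only [hZ]; rw [AddCircle.coe_add_period]
  have hval : ∀ s ∈ Ico 0 (S + τ), Z s = c s := by
    intro s hs; exact AddCircle.liftIco_zero_coe_apply hs
  refine ⟨Z, ?_, hper, ?_, ?_⟩
  · have := AddCircle.liftIco_zero_continuous (p := S + τ) (f := c) (by rw [c0, c1]) hcc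
    exact this.comp (AddCircle.continuous_mk' (S + τ))
  · intro s hs
    rw [hval s ⟨hs.1, by linarith [hs.2]⟩]
    simp only [hc]; rw [if_pos hs.2]
  · intro s hs
    rcases eq_or_lt_of_le hs.1 with h | h
    · rw [← h, hval _ ⟨by linarith, by linarith⟩]
      simp only [hc]; rw [if_pos (by linarith), add_zero, L.send, L.g0]
    rcases eq_or_lt_of_le hs.2 with h' | h'
    · rw [h', L.gend, ← c0, ← hval 0 ⟨le_rfl, by linarith⟩]
      have := hper 0
      rwa [zero_add] at this
    · rw [hval _ ⟨by linarith, by linarith⟩]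
      simp only [hc]; rw [if_neg (by linarith), add_sub_cancel_left]

lemma reduce {Z : ℝ → ℂ} {T : ℝ} (hT : 0 < T) (h : Function.Periodic Z T) (t : ℝ) :
    ∃ q, Function.Periodic Z q ∧ t + q ∈ Ico 0 T := by
  obtain ⟨n, hn, _⟩ := existsUnique_add_zsmul_mem_Ico hT t 0
  exact ⟨n • T, h.zsmul n, by simpa using hn⟩

section closed
variable {y x S τ : ℝ} {γ Z : ℝ → ℂ}

lemma closed_cases (L : Lap e μ y x y S τ γ) (C : Closed μ y S τ γ Z) {t : ℝ}
    (ht : t ∈ Ico 0 (S + τ)) :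
    (t = 0 ∧ Z t = -(y : ℂ) + I) ∨ (t ∈ Ioo 0 S ∧ (Z t).im < 1 ∧ Z t = spir μ y t) ∨
    (t = S ∧ Z t = (x : ℂ) + I) ∨ (t ∈ Ioo S (S + τ) ∧ 1 < (Z t).im ∧ Z t = γ (t - S)) := by
  have hS := L.hS
  rcases eq_or_lt_of_le ht.1 with h | h
  · left; exact ⟨h.symm, by rw [← h, C.low 0 ⟨le_rfl, hS.le⟩, spir_zero]⟩
  rcases lt_trichotomy t S with h' | h' | h'
  · right; left
    have := C.low t ⟨h.le, h'.le⟩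
    exact ⟨⟨h, h'⟩, by rw [this]; exact L.slt t ⟨h, h'⟩, this⟩
  · right; right; left
    exact ⟨h', by rw [h', C.low S ⟨hS.le, le_rfl⟩, L.send]⟩
  · right; right; right
    have := C.up (t - S) ⟨by linarith, by linarith [ht.2]⟩
    rw [add_sub_cancel] at this
    exact ⟨⟨h', ht.2⟩, by rw [this]; exact L.ggt _ ⟨by linarith, by linarith [ht.2]⟩, this⟩

lemma closed_norm (hs : SmallPert e μ) (L : Lap e μ y x y S τ γ) (C : Closed μ y S τ γ Z) (t : ℝ) :
    101 / 100 < ‖Z t‖ ∧ ‖Z t‖ < 7 := by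
  obtain ⟨q, hq, hm⟩ := reduce (by linarith [L.hS, L.hτ]) C.per t
  rw [← hq t]
  rcases le_or_gt (t + q) S with h | h
  · rw [C.low _ ⟨hm.1, h⟩]
    have := spir_norm_bd hs.mu L.hy (s := t + q) ⟨hm.1, h.trans L.hS2⟩
    constructor <;> linarith [this.1, this.2]
  · have := C.up (t + q - S) ⟨by linarith, by linarith [hm.2]⟩
    rw [add_sub_cancel] at this
    rw [this]
    exact L.gn _ ⟨by linarith, by linarith [hm.2]⟩

lemma fderiv_curve {g : ℂ → ℝ} (hg : g ∈ curvesLines) (z v : ℂ) : fderiv ℝ g z v = v.im := by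
  have h1 : HasFDerivAt (fun z : ℂ => z.im) imCLM z := imCLM.hasFDerivAt
  rcases hg with rfl | hg
  · rw [(h1.sub_const 1).fderiv]; rfl
  · rw [mem_singleton_iff] at hg
    subst hg
    rw [(h1.add_const 1).fderiv]; rfl

/-- crossing condition at a time -/
def CrossAt (e : ℂ → ℂ) (μ : ℝ) (Z : ℝ → ℂ) (t : ℝ) : Prop :=
  ∃ σ₁ σ₂ : Fin 3, σ₁ ≠ σ₂ ∧
    (∃ ε > 0, (∀ s ∈ Set.Ioo (t - ε) t, Z s ∈ zonesLines σ₁) ∧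
                  (∀ s ∈ Set.Ioo t (t + ε), Z s ∈ zonesLines σ₂)) ∧
    (∀ g ∈ curvesLines, g (Z t) = 0 →
          fderiv ℝ g (Z t) (pwField e μ σ₁ (Z t)) ≠ 0 ∧
          fderiv ℝ g (Z t) (pwField e μ σ₂ (Z t)) ≠ 0 ∧
          (0 < fderiv ℝ g (Z t) (pwField e μ σ₁ (Z t)) ↔
           0 < fderiv ℝ g (Z t) (pwField e μ σ₂ (Z t))))

lemma crossAt_of {t : ℝ} (σ₁ σ₂ : Fin 3) (hne : σ₁ ≠ σ₂)
    (hl : ∀ᶠ s in 𝓝[<] t, Z s ∈ zonesLines σ₁) (hr : ∀ᶠ s in 𝓝[>] t, Z s ∈ zonesLines σ₂)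
    (hsgn : 0 < (pwField e μ σ₁ (Z t)).im * (pwField e μ σ₂ (Z t)).im) : CrossAt e μ Z t := by
  refine ⟨σ₁, σ₂, hne, ?_, ?_⟩
  · obtain ⟨a, ha, ha2⟩ := mem_nhdsLT_iff_exists_Ioo_subset.1 hl
    obtain ⟨b, hb, hb2⟩ := mem_nhdsGT_iff_exists_Ioo_subset.1 hr
    have ha' : a < t := ha
    have hb' : t < b := hb
    refine ⟨min (t - a) (b - t), lt_min (by linarith) (by linarith), ?_, ?_⟩
    · intro s hs
      have := min_le_left (t - a) (b - t)
      exact ha2 ⟨by linarith [hs.1], hs.2⟩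
    · intro s hs
      have := min_le_right (t - a) (b - t)
      exact hb2 ⟨hs.1, by linarith [hs.2]⟩
  · intro g hg _
    rw [fderiv_curve hg, fderiv_curve hg]
    rcases mul_pos_iff.1 hsgn with h | h
    · exact ⟨h.1.ne', h.2.ne', iff_of_true h.1 h.2⟩
    · exact ⟨h.1.ne, h.2.ne, iff_of_false (not_lt.2 h.1.le) (not_lt.2 h.2.le)⟩

lemma crossAt_shift {t q : ℝ} (hq : Function.Periodic Z q) (h : CrossAt e μ Z (t + q)) :
    CrossAt e μ Z t := by
  obtain ⟨σ₁, σ₂, hne, ⟨ε, hε, h1, h2⟩, h3⟩ := h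
  rw [hq t] at h3
  refine ⟨σ₁, σ₂, hne, ⟨ε, hε, ?_, ?_⟩, h3⟩
  · intro s hs
    rw [← hq s]; exact h1 _ ⟨by linarith [hs.1], by linarith [hs.2]⟩
  · intro s hs
    rw [← hq s]; exact h2 _ ⟨by linarith [hs.1], by linarith [hs.2]⟩

lemma closed_cross (hs : SmallPert e μ) (L : Lap e μ y x y S τ γ) (C : Closed μ y S τ γ Z) {t : ℝ}
    (ht : t ∈ Ico 0 (S + τ)) (him : (Z t).im = 1 ∨ (Z t).im = -1) : CrossAt e μ Z t := by
  have hS := L.hS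
  have hτ := L.hτ
  have hmu := abs_le.1 hs.mu
  norm_num at hmu
  have hcim : Continuous fun s => (Z s).im := continuous_im.comp C.cont
  have near1 : (Z t).im = 1 → ∀ᶠ s in 𝓝 t, -1 < (Z s).im := fun h =>
    hcim.continuousAt.tendsto.eventually (lt_mem_nhds (by rw [h]; norm_num))
  have near2 : (Z t).im = -1 → ∀ᶠ s in 𝓝 t, (Z s).im < 1 := fun h =>
    hcim.continuousAt.tendsto.eventually (gt_mem_nhds (by rw [h]; norm_num))
  have hn := (closed_norm hs L C t).2
  have hf0 := abs_le.1 (field0_im hs (z := Z t) (by linarith))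
  have hf1 := field1_im (e := e) (μ := μ) (Z t)
  norm_num only at hf0
  rcases closed_cases L C ht with ⟨h0, hz⟩ | ⟨hI, hlt, hz⟩ | ⟨h0, hz⟩ | ⟨hI, hgt, hz⟩
  · have i1 : (Z t).im = 1 := by simp [hz]
    have r1 : (Z t).re = -y := by simp [hz]
    refine crossAt_of 0 1 (by decide) ?_ ?_ ?_
    · rw [h0]
      filter_upwards [Ioo_mem_nhdsLT (show -τ < 0 by linarith)] with s hs'
      rw [← C.per s, mem_zone0]
      have := C.up (s + τ) ⟨by linarith [hs'.1], by linarith [hs'.2]⟩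
      rw [show s + (S + τ) = S + (s + τ) by ring, this]
      exact L.ggt _ ⟨by linarith [hs'.1], by linarith [hs'.2]⟩
    · filter_upwards [(near1 i1).filter_mono nhdsWithin_le_nhds,
        Ioo_mem_nhdsGT (show t < S by linarith)] with s hs1 hs2
      rw [mem_zone1, abs_lt]
      refine ⟨hs1, ?_⟩
      rw [C.low s ⟨by linarith [hs2.1], hs2.2.le⟩]
      exact L.slt s ⟨by linarith [hs2.1], hs2.2⟩
    · rw [hf1, i1, r1]
      rw [r1] at hf0
      exact mul_pos_of_neg_of_neg (by linarith [hf0.2, L.hy.1]) (by linarith [L.hy.1])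
  · have i1 : (Z t).im = -1 := by
      rcases him with h | h
      · linarith
      · exact h
    have hev : Z =ᶠ[𝓝 t] spir μ y := by
      filter_upwards [Ioo_mem_nhds hI.1 hI.2] with s hs'
      exact C.low s (Ioo_subset_Icc_self hs')
    have hd : HasDerivAt (fun s => (Z s).im) ((pwField e μ 1 (Z t)).im) t := by
      have := hasDerivAt_im ((spir_deriv e μ y t).congr_of_eventuallyEq hev)
      rwa [← hz] at this
    have hb := (spir_norm_bd hs.mu L.hy (s := t) ⟨hI.1.le, hI.2.le.trans L.hS2⟩).1
    rw [← hz] at hb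
    have hsq := sq_norm_eq (Z t)
    rw [i1] at hsq hf1
    have hre : 1 / 25 ≤ (Z t).re ^ 2 := by nlinarith
    have hzone : ∀ s, -1 < (Z s).im → (Z s).im < 1 → Z s ∈ zonesLines 1 := by
      intro s h1 h2; rw [mem_zone1, abs_lt]; exact ⟨h1, h2⟩
    rcases lt_or_ge 0 (Z t).re with h | h
    · have hpos : 0 < (pwField e μ 1 (Z t)).im := by rw [hf1]; nlinarith
      refine crossAt_of 2 1 (by decide) ?_ ?_ (mul_pos hpos hpos)
      · filter_upwards [left_deriv_pos hd hpos] with s hs'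
        rw [mem_zone2]; linarith
      · filter_upwards [right_deriv_pos hd.hasDerivWithinAt hpos,
          (near2 i1).filter_mono nhdsWithin_le_nhds] with s hs1 hs2
        exact hzone s (by linarith) hs2
    · have hneg : (pwField e μ 1 (Z t)).im < 0 := by rw [hf1]; nlinarith
      refine crossAt_of 1 2 (by decide) ?_ ?_ (mul_pos_of_neg_of_neg hneg hneg)
      · filter_upwards [left_deriv_neg hd hneg,
          (near2 i1).filter_mono nhdsWithin_le_nhds] with s hs1 hs2
        exact hzone s (by linarith) hs2
      · filter_upwards [right_deriv_neg hd.hasDerivWithinAt hneg] with s hs'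
        rw [mem_zone2]; linarith
  · have i1 : (Z t).im = 1 := by simp [hz]
    have r1 : (Z t).re = x := by simp [hz]
    refine crossAt_of 1 0 (by decide) ?_ ?_ ?_
    · filter_upwards [(near1 i1).filter_mono nhdsWithin_le_nhds,
        Ioo_mem_nhdsLT (show 0 < t by linarith)] with s hs1 hs2
      rw [mem_zone1, abs_lt]
      refine ⟨hs1, ?_⟩
      rw [C.low s ⟨hs2.1.le, by linarith [hs2.2]⟩]
      exact L.slt s ⟨hs2.1, by linarith [hs2.2]⟩
    · filter_upwards [Ioo_mem_nhdsGT (show t < S + τ by linarith)] with s hs'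
      rw [mem_zone0]
      have := C.up (s - S) ⟨by linarith [hs'.1], by linarith [hs'.2]⟩
      rw [add_sub_cancel] at this
      rw [this]
      exact L.ggt _ ⟨by linarith [hs'.1], by linarith [hs'.2]⟩
    · rw [hf1, i1, r1]
      rw [r1] at hf0
      exact mul_pos (by linarith [hf0.1, L.hx.1]) (by linarith [L.hx.1])
  · rcases him with h | h <;> linarith

lemma closed_orbit (hs : SmallPert e μ) (L : Lap e μ y x y S τ γ) (C : Closed μ y S τ γ Z) :
    IsCrossingPeriodicOrbit zonesLines (pwField e μ) curvesLines Z := by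
  have hS := L.hS
  have hτ := L.hτ
  have hT : 0 < S + τ := by linarith
  have hcr : ∀ t, ((Z t).im = 1 ∨ (Z t).im = -1) → CrossAt e μ Z t := by
    intro t ht
    obtain ⟨q, hq, hm⟩ := reduce hT C.per t
    refine crossAt_shift hq (closed_cross hs L C hm ?_)
    rwa [hq t]
  refine ⟨S + τ, hT, C.cont, C.per, ⟨0, S, ?_⟩, ?_, ?_, ?_⟩
  · rw [C.low 0 ⟨le_rfl, hS.le⟩, C.low S ⟨hS.le, le_rfl⟩, L.send, spir_zero]
    intro h
    have := congrArg Complex.re h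
    simp at this
    linarith [L.hy.1, L.hx.1]
  · intro t σ hσ
    obtain ⟨q, hq, hm⟩ := reduce hT C.per t
    have hder : HasDerivAt Z (pwField e μ σ (Z (t + q))) (t + q) := by
      rw [← hq t] at hσ
      generalize t + q = u at *
      rcases closed_cases L C hm with ⟨h0, hz⟩ | ⟨hI, hlt, hz⟩ | ⟨h0, hz⟩ | ⟨hI, hgt, hz⟩
      · exfalso
        rcases fin3_cases σ with rfl | rfl | rfl
        · rw [mem_zone0, hz] at hσ; simp at hσ
        · rw [mem_zone1, hz] at hσ; simp at hσ
        · rw [mem_zone2, hz] at hσ; simp at hσ; linarith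
      · have hev : Z =ᶠ[𝓝 u] spir μ y := by
          filter_upwards [Ioo_mem_nhds hI.1 hI.2] with s hs'
          exact C.low s (Ioo_subset_Icc_self hs')
        have hd := (spir_deriv e μ y u).congr_of_eventuallyEq hev
        rw [← hz] at hd
        rcases fin3_cases σ with rfl | rfl | rfl
        · rw [mem_zone0] at hσ; linarith
        · exact hd
        · exact hd
      · exfalso
        rcases fin3_cases σ with rfl | rfl | rfl
        · rw [mem_zone0, hz] at hσ; simp at hσ
        · rw [mem_zone1, hz] at hσ; simp at hσ
        · rw [mem_zone2, hz] at hσ; simp at hσ; linarith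
      · have hev : Z =ᶠ[𝓝 u] fun s => γ (s - S) := by
          filter_upwards [Ioo_mem_nhds hI.1 hI.2] with s hs'
          have := C.up (s - S) ⟨by linarith [hs'.1], by linarith [hs'.2]⟩
          rwa [add_sub_cancel] at this
        have hd0 : HasDerivAt (fun s => γ (s - S)) (pwField e μ 0 (γ (u - S))) u :=
          (L.gd (u - S) ⟨by linarith [hI.1], by linarith [hI.2]⟩).comp_sub_const u S
        have hd := hd0.congr_of_eventuallyEq hev
        rw [← hz] at hd
        rcases fin3_cases σ with rfl | rfl | rfl
        · exact hd
        · rw [mem_zone1] at hσ; linarith [(abs_lt.1 hσ).2]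
        · rw [mem_zone2] at hσ; linarith
    rw [hq t] at hder
    have h2 : HasDerivAt (fun s => Z (s + q)) (pwField e μ σ (Z t)) t :=
      HasDerivAt.comp_add_const t q hder
    have h3 : (fun s => Z (s + q)) = Z := funext hq
    rwa [h3] at h2
  · simp only [curves_iff]
    by_contra hinf
    have hinf : Set.Infinite {t ∈ Ico (0 : ℝ) (S + τ) | (Z t).im = 1 ∨ (Z t).im = -1} := hinf
    obtain ⟨t, -, ht⟩ := hinf.exists_accPt_of_subset_isCompact (isCompact_Icc (a := (0 : ℝ))
      (b := S + τ)) (fun t ht => Ico_subset_Icc_self ht.1)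
    rw [accPt_iff_frequently_nhdsNE] at ht
    apply ht
    by_cases hc : (Z t).im = 1 ∨ (Z t).im = -1
    · obtain ⟨σ₁, σ₂, -, ⟨ε, hε, h1, h2⟩, -⟩ := hcr t hc
      have hz : ∀ (σ : Fin 3) (z : ℂ), z ∈ zonesLines σ → ¬ (z.im = 1 ∨ z.im = -1) := by
        intro σ z hz hh
        rcases fin3_cases σ with rfl | rfl | rfl
        · rw [mem_zone0] at hz; rcases hh with hh | hh <;> linarith
        · rw [mem_zone1, abs_lt] at hz; rcases hh with hh | hh <;> linarith [hz.1, hz.2]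
        · rw [mem_zone2] at hz; rcases hh with hh | hh <;> linarith
      rw [eventually_nhdsWithin_iff]
      filter_upwards [Ioo_mem_nhds (show t - ε < t by linarith) (show t < t + ε by linarith)]
        with s hs' hne hh
      rcases lt_or_gt_of_ne (show s ≠ t from hne) with h | h
      · exact hz σ₁ _ (h1 s ⟨hs'.1, h⟩) hh.2
      · exact hz σ₂ _ (h2 s ⟨h, hs'.2⟩) hh.2
    · have hcl : IsClosed {s | (Z s).im = 1 ∨ (Z s).im = -1} := by
        have hcim : Continuous fun s => (Z s).im := continuous_im.comp C.cont
        exact (isClosed_eq hcim continuous_const).union (isClosed_eq hcim continuous_const)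
      refine Filter.Eventually.filter_mono nhdsWithin_le_nhds ?_
      filter_upwards [hcl.isOpen_compl.mem_nhds hc] with s hs' hh
      exact hs' hh.2
  · intro t ht
    rw [curves_iff] at ht
    exact hcr t ht

lemma closed_left (L : Lap e μ y x y S τ γ) (C : Closed μ y S τ γ Z) {t : ℝ}
    (h1 : (Z t).im = 1) (h2 : (Z t).re ≤ 0) : Z t = -(y : ℂ) + I := by
  obtain ⟨q, hq, hm⟩ := reduce (by linarith [L.hS, L.hτ]) C.per t
  rw [← hq t] at h1 h2 ⊢
  rcases closed_cases L C hm with ⟨h0, hz⟩ | ⟨hI, hlt, hz⟩ | ⟨h0, hz⟩ | ⟨hI, hgt, hz⟩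
  · exact hz
  · linarith
  · rw [hz] at h2; simp at h2; linarith [L.hx.1]
  · linarith

/-- An orbit through the base point of the closed lap has the same image. -/
lemma closed_range (hs : SmallPert e μ) (L : Lap e μ y x y S τ γ) (C : Closed μ y S τ γ Z)
    {w : ℝ → ℂ} (hw : IsCrossingPeriodicOrbit zonesLines (pwField e μ) curvesLines w) {t0 : ℝ}
    (h0 : w t0 = -(y : ℂ) + I) : range w = range Z := by
  have hS := L.hS
  have hτ := L.hτ
  have hT : 0 < S + τ := by linarith
  have step : ∀ t, w t = -(y : ℂ) + I → ∀ s ∈ Icc 0 (S + τ), w (t + s) = Z s := by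
    intro t ht s hs'
    obtain ⟨f1, f2⟩ := lap_follow hs hw L ht
    rcases le_or_gt s S with h | h
    · rw [f1 s ⟨hs'.1, h⟩, C.low s ⟨hs'.1, h⟩]
    · have a1 := f2 (s - S) ⟨by linarith, by linarith [hs'.2]⟩
      have a2 := C.up (s - S) ⟨by linarith, by linarith [hs'.2]⟩
      rw [add_sub_cancel] at a2
      rw [a2, ← a1]
      congr 1; ring
  have hZT : Z (S + τ) = -(y : ℂ) + I := by
    rw [C.up τ ⟨hτ.le, le_rfl⟩, L.gend]
  have base : ∀ n : ℕ, w (t0 + n * (S + τ)) = -(y : ℂ) + I := by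
    intro n
    induction n with
    | zero => simpa using h0
    | succ n ih =>
      have := step _ ih (S + τ) ⟨hT.le, le_rfl⟩
      rw [hZT] at this
      rw [← this]; congr 1; push_cast; ring
  obtain ⟨Tw, hTw, -, hwper, -⟩ := hw
  apply Subset.antisymm
  · rintro _ ⟨t, rfl⟩
    obtain ⟨n, hn⟩ := exists_nat_gt ((t0 - t) / Tw)
    rw [div_lt_iff₀ hTw] at hn
    have e1 : w (t + n * Tw) = w t := hwper.nat_mul n t
    rw [← e1]
    set t' := t + n * Tw
    have ht' : 0 ≤ t' - t0 := by simp only [t']; linarith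
    set m := ⌊(t' - t0) / (S + τ)⌋₊ with hm
    have m1 := Nat.floor_le (div_nonneg ht' hT.le)
    have m2 := Nat.lt_floor_add_one ((t' - t0) / (S + τ))
    rw [← hm] at m1 m2
    rw [le_div_iff₀ hT] at m1
    rw [div_lt_iff₀ hT] at m2
    have := step _ (base m) (t' - (t0 + m * (S + τ))) ⟨by linarith, by linarith⟩
    rw [add_sub_cancel] at this
    exact ⟨_, this.symm⟩
  · rintro _ ⟨t, rfl⟩
    obtain ⟨q, hq, hm⟩ := reduce hT C.per t
    rw [← hq t, ← step t0 h0 _ (Ico_subset_Icc_self hm)]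
    exact mem_range_self _

end closed
end lap


section geom
variable {e : ℂ → ℂ} {μ : ℝ} {F : ℂ → ℂ} {X : ℝ → ℝ}

lemma const_sign {f : ℝ → ℝ} {J : Set ℝ} (hJ : IsPreconnected J) (hc : ContinuousOn f J)
    (hne : ∀ y ∈ J, f y ≠ 0) : (∀ y ∈ J, 0 < f y) ∨ (∀ y ∈ J, f y < 0) := by
  by_contra hcon
  push Not at hcon
  obtain ⟨⟨a, ha, ha2⟩, ⟨b, hb, hb2⟩⟩ := hcon
  obtain ⟨c, hc1, hc2⟩ := hJ.intermediate_value ha hb hc ⟨ha2, hb2⟩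
  exact hne c hc1 hc2

/-- zeros of the displacement function are isolated -/
lemma DD_isolated (hs : SmallPert e μ) (hF : IsPrim e F) (hX : IsX μ X) {u y : ℝ}
    (hu : u ∈ Icc (1 / 4 : ℝ) 4) (hy : y ∈ Icc (1 / 4 : ℝ) 4) (hne : DD F X u ≠ 0) :
    ∀ᶠ z in 𝓝[≠] y, DD F X z ≠ 0 := by
  have han : AnalyticOnNhd ℝ (DD F X) (Ioo (6 / 25 : ℝ) (9 / 2)) := fun z hz =>
    DD_analytic hs.mu hF hX hz
  have hy' : y ∈ Ioo (6 / 25 : ℝ) (9 / 2) := ⟨by linarith [hy.1], by linarith [hy.2]⟩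
  have hu' : u ∈ Ioo (6 / 25 : ℝ) (9 / 2) := ⟨by linarith [hu.1], by linarith [hu.2]⟩
  by_contra hcon
  have hfr : ∃ᶠ z in 𝓝[≠] y, DD F X z = 0 := by
    rw [Filter.not_eventually] at hcon
    exact hcon.mono fun z hz => not_not.1 hz
  exact hne (han.eqOn_zero_of_preconnected_of_frequently_eq_zero isPreconnected_Ioo hy' hfr hu')

lemma finite_hits {w : ℝ → ℂ}
    (hw : IsCrossingPeriodicOrbit zonesLines (pwField e μ) curvesLines w) :
    {y : ℝ | ∃ t, w t = -(y : ℂ) + I}.Finite := by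
  obtain ⟨T, hT, -, hper, -, -, hfin, -⟩ := hw
  refine (hfin.image (fun t => -(w t).re)).subset ?_
  rintro y ⟨t, ht⟩
  obtain ⟨t', ht', htt⟩ := hper.exists_mem_Ico₀ hT t
  refine ⟨t', ⟨ht', ?_⟩, ?_⟩
  · rw [curves_iff, ← htt, ht]; simp
  · simp only; rw [← htt, ht]; simp

lemma DD_sign_iff (hs : SmallPert e μ) (hF : IsPrim e F) {y y1 : ℝ}
    (hy : y ∈ Icc (1 / 20 : ℝ) (13 / 2)) (hy1 : y1 ∈ Icc (1 / 20 : ℝ) (13 / 2))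
    (hQ : QQ F (X y) = QQ F (-y1)) :
    (0 < DD F X y → y1 < y) ∧ (DD F X y < 0 → y < y1) := by
  have hm := QQ_mono hs hF
  have m1 : -y ∈ Icc (-(69 / 10) : ℝ) (-(1 / 100)) := ⟨by linarith [hy.2], by linarith [hy.1]⟩
  have m2 : -y1 ∈ Icc (-(69 / 10) : ℝ) (-(1 / 100)) := ⟨by linarith [hy1.2], by linarith [hy1.1]⟩
  simp only [DD, hQ]
  constructor
  · intro h
    have := (hm.lt_iff_lt m1 m2).1 (by linarith)
    linarith
  · intro h
    have := (hm.lt_iff_lt m2 m1).1 (by linarith)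
    linarith

lemma return_side (hs : SmallPert e μ) (hF : IsPrim e F) (hX : IsX μ X) {p y y1 : ℝ}
    (hp : p ∈ Icc (6 / 25 : ℝ) (9 / 2)) (h0 : DD F X p = 0)
    (hy : y ∈ Icc (6 / 25 : ℝ) (9 / 2)) (hy1 : y1 ∈ Icc (1 / 20 : ℝ) (13 / 2))
    (hQ : QQ F (X y) = QQ F (-y1)) : (p < y → p < y1) ∧ (y < p → y1 < p) := by
  have hm := QQ_mono hs hF
  have ha := QQ_anti hs hF
  have m1 : -p ∈ Icc (-(69 / 10) : ℝ) (-(1 / 100)) := ⟨by linarith [hp.2], by linarith [hp.1]⟩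
  have m2 : -y1 ∈ Icc (-(69 / 10) : ℝ) (-(1 / 100)) := ⟨by linarith [hy1.2], by linarith [hy1.1]⟩
  have x1 := X_mem hs.mu hX hp
  have x2 := X_mem hs.mu hX hy
  have n1 : X p ∈ Icc (1 / 100 : ℝ) (69 / 10) := ⟨by linarith [x1.1], by linarith [x1.2]⟩
  have n2 : X y ∈ Icc (1 / 100 : ℝ) (69 / 10) := ⟨by linarith [x2.1], by linarith [x2.2]⟩
  simp only [DD] at h0
  constructor
  · intro h
    have h1 := ha n1 n2 (X_mono hs.mu hX hp hy h)
    have := (hm.lt_iff_lt m2 m1).1 (by linarith)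
    linarith
  · intro h
    have h1 := ha n2 n1 (X_mono hs.mu hX hy hp h)
    have := (hm.lt_iff_lt m1 m2).1 (by linarith)
    linarith

theorem geom (hs : SmallPert e μ) (hF : IsPrim e F) (hX : IsX μ X) {u v : ℝ}
    (hu : u ∈ Icc (1 / 4 : ℝ) 4) (hv : v ∈ Icc (1 / 4 : ℝ) 4) (huv : u < v)
    (hsign : DD F X u * DD F X v < 0) :
    ∃ Z : ℝ → ℂ, IsCrossingLimitCycle zonesLines (pwField e μ) curvesLines Z ∧
      ∃ p ∈ Ioo u v, ∀ y : ℝ, 0 ≤ y → (-(y : ℂ) + I ∈ range Z ↔ y = p) := by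
  have hun : DD F X u ≠ 0 := by intro h; rw [h] at hsign; simp at hsign
  have hvn : DD F X v ≠ 0 := by intro h; rw [h] at hsign; simp at hsign
  have hcont : ContinuousOn (DD F X) (Ioo (6 / 25 : ℝ) (9 / 2)) := fun z hz =>
    (DD_analytic hs.mu hF hX hz).continuousAt.continuousWithinAt
  have hsub : Icc u v ⊆ Ioo (6 / 25 : ℝ) (9 / 2) := fun z hz =>
    ⟨by linarith [hz.1, hu.1], by linarith [hz.2, hv.2]⟩
  -- a zero
  obtain ⟨p, hp, hp0⟩ : ∃ p ∈ Icc u v, DD F X p = 0 := by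
    by_contra hcon
    push Not at hcon
    have hh := const_sign isPreconnected_Icc (hcont.mono hsub) hcon
    have mu' : u ∈ Icc u v := ⟨le_rfl, huv.le⟩
    have mv' : v ∈ Icc u v := ⟨huv.le, le_rfl⟩
    rcases hh with h | h
    · exact absurd hsign (not_lt.2 (mul_pos (h u mu') (h v mv')).le)
    · exact absurd hsign (not_lt.2 (mul_pos_of_neg_of_neg (h u mu') (h v mv')).le)
  have hpu : u < p := lt_of_le_of_ne hp.1 (by rintro rfl; exact hun hp0)
  have hpv : p < v := lt_of_le_of_ne hp.2 (by rintro rfl; exact hvn hp0)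
  have hp4 : p ∈ Icc (1 / 4 : ℝ) 4 := ⟨by linarith [hu.1], by linarith [hv.2]⟩
  have hpI : p ∈ Icc (6 / 25 : ℝ) (9 / 2) := ⟨by linarith [hp4.1], by linarith [hp4.2]⟩
  -- isolation
  have hiso := DD_isolated hs hF hX hu hp4 hun
  rw [eventually_nhdsWithin_iff, Metric.eventually_nhds_iff] at hiso
  obtain ⟨δ0, hδ0, hiso⟩ := hiso
  set δ := min δ0 (1 / 100) with hδ
  have hδpos : 0 < δ := lt_min hδ0 (by norm_num)
  have hδ1 : δ ≤ 1 / 100 := min_le_right _ _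
  have hδ2 : δ ≤ δ0 := min_le_left _ _
  have hiso' : ∀ y, |y - p| < δ → y ≠ p → DD F X y ≠ 0 := fun y hy hne =>
    hiso (by rw [Real.dist_eq]; linarith) hne
  have hnear : ∀ y, |y - p| < δ → y ∈ Ioo (6 / 25 : ℝ) (9 / 2) := by
    intro y hy
    rw [abs_lt] at hy
    exact ⟨by linarith [hy.1, hp4.1], by linarith [hy.2, hp4.2]⟩
  -- the closed lap
  obtain ⟨y1, S, τ, γ, L, b1, b2, hQ⟩ := lap_exists hs hF hX hpI
  have hy1p : y1 = p := by
    have hm := QQ_mono hs hF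
    have m1 : -p ∈ Icc (-(69 / 10) : ℝ) (-(1 / 100)) := ⟨by linarith [hpI.2], by linarith [hpI.1]⟩
    have m2 : -y1 ∈ Icc (-(69 / 10) : ℝ) (-(1 / 100)) := ⟨by linarith, by linarith⟩
    have := hm.injOn m2 m1 (by simp only [DD] at hp0; linarith)
    linarith
  rw [hy1p] at L
  obtain ⟨Z, C⟩ := closed_exists L
  have hZ0 : Z 0 = -(p : ℂ) + I := by rw [C.low 0 ⟨le_rfl, L.hS.le⟩, spir_zero]
  refine ⟨Z, ⟨closed_orbit hs L C, ?_⟩, p, ⟨hpu, hpv⟩, ?_⟩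
  · set K : Set ℂ := {z : ℂ | z.im = 1 ∧ z.re ≤ 0 ∧ δ ≤ |-z.re - p|} with hK
    have hKc : IsClosed K := by
      have k1 : IsClosed {z : ℂ | z.im = 1} := isClosed_eq continuous_im continuous_const
      have k2 : IsClosed {z : ℂ | z.re ≤ 0} := isClosed_le continuous_re continuous_const
      have k3 : IsClosed {z : ℂ | δ ≤ |-z.re - p|} := by
        apply isClosed_le continuous_const
        exact ((continuous_re.neg).sub continuous_const).abs
      exact k1.inter (k2.inter k3)
    refine ⟨{z : ℂ | 101 / 100 < ‖z‖} ∩ {z : ℂ | ‖z‖ < 7} ∩ Kᶜ,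
      ((isOpen_lt continuous_const continuous_norm).inter
        (isOpen_lt continuous_norm continuous_const)).inter hKc.isOpen_compl, ?_, ?_⟩
    · rintro _ ⟨t, rfl⟩
      refine ⟨closed_norm hs L C t, ?_⟩
      rintro ⟨k1, k2, k3⟩
      rw [closed_left L C k1 k2] at k3
      simp at k3
      linarith
    · intro w hw hwU
      have hann : ∀ t, 101 / 100 < ‖w t‖ ∧ ‖w t‖ < 7 := fun t => (hwU (mem_range_self t)).1
      have hclose : ∀ t y : ℝ, 0 ≤ y → w t = -(y : ℂ) + I → |y - p| < δ := by
        intro t y hy ht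
        by_contra hc
        push Not at hc
        refine (hwU (mem_range_self t)).2 ?_
        rw [ht]
        refine ⟨by simp, by simpa using hy, by simpa using hc⟩
      -- the return map on hits
      have hret : ∀ y : ℝ, 0 ≤ y → (∃ t, w t = -(y : ℂ) + I) →
          ∃ y' : ℝ, 0 ≤ y' ∧ (∃ t, w t = -(y' : ℂ) + I) ∧ y ∈ Icc (6 / 25 : ℝ) (9 / 2) ∧
            y' ∈ Icc (1 / 20 : ℝ) (13 / 2) ∧ QQ F (X y) = QQ F (-y') := by
        rintro y hy ⟨t, ht⟩
        have hyI := Ioo_subset_Icc_self (hnear y (hclose t y hy ht))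
        obtain ⟨y', S', τ', γ', L', c1, c2, hQ'⟩ := lap_exists hs hF hX hyI
        have := (lap_follow hs hw L' ht).2 τ' ⟨L'.hτ.le, le_rfl⟩
        rw [L'.gend] at this
        exact ⟨y', by linarith, ⟨_, this⟩, hyI, ⟨c1, c2⟩, hQ'⟩
      -- no hits in a punctured one-sided neighbourhood
      have hno : ∀ J : Set ℝ, IsPreconnected J → (∀ y ∈ J, |y - p| < δ ∧ y ≠ p) →
          (∀ y y' : ℝ, 0 ≤ y' → y ∈ J → (∃ t, w t = -(y' : ℂ) + I) → y ∈ Icc (6 / 25 : ℝ) (9 / 2) →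
            y' ∈ Icc (1 / 20 : ℝ) (13 / 2) → QQ F (X y) = QQ F (-y') → y' ∈ J) →
          ∀ y ∈ J, 0 ≤ y → ¬ ∃ t, w t = -(y : ℂ) + I := by
        intro J hJ hJ2 hJ3 y hyJ hy0 hyt
        set B := {y : ℝ | ∃ t, w t = -(y : ℂ) + I} ∩ (J ∩ Ici 0) with hB
        have hBf : B.Finite := (finite_hits hw).subset inter_subset_left
        have hBn : B.Nonempty := ⟨y, hyt, hyJ, hy0⟩
        have hBr : ∀ y ∈ B, ∃ y' ∈ B, y ∈ Icc (1 / 20 : ℝ) (13 / 2) ∧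
            y' ∈ Icc (1 / 20 : ℝ) (13 / 2) ∧ QQ F (X y) = QQ F (-y') := by
          rintro y ⟨h1, h2, h3⟩
          obtain ⟨y', d1, d2, d3, d4, d5⟩ := hret y h3 h1
          exact ⟨y', ⟨d2, hJ3 y y' d1 h2 d2 d3 d4 d5, d1⟩,
            ⟨by linarith [d3.1], by linarith [d3.2]⟩, d4, d5⟩
        have hsg := const_sign hJ (hcont.mono fun y hy => hnear y (hJ2 y hy).1)
          (fun y hy => hiso' y (hJ2 y hy).1 (hJ2 y hy).2)
        rcases hsg with hsg | hsg
        · obtain ⟨m, hm, hmin⟩ := Set.exists_min_image B id hBf hBn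
          obtain ⟨y', hy', k1, k2, k3⟩ := hBr m hm
          have := (DD_sign_iff hs hF k1 k2 k3).1 (hsg m hm.2.1)
          exact absurd (hmin y' hy') (not_le.2 this)
        · obtain ⟨m, hm, hmax⟩ := Set.exists_max_image B id hBf hBn
          obtain ⟨y', hy', k1, k2, k3⟩ := hBr m hm
          have := (DD_sign_iff hs hF k1 k2 k3).2 (hsg m hm.2.1)
          exact absurd (hmax y' hy') (not_le.2 this)
      obtain ⟨t0, y0, hy0, ht0⟩ := orbit_meets hs hw hann
      have hy0p : y0 = p := by
        have hc0 := abs_lt.1 (hclose t0 y0 hy0 ht0)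
        rcases lt_trichotomy y0 p with h | h | h
        · exfalso
          refine hno (Ioo (p - δ) p) isPreconnected_Ioo ?_ ?_ y0 ⟨by linarith [hc0.1], h⟩ hy0
            ⟨t0, ht0⟩
          · intro y hy
            exact ⟨abs_lt.2 ⟨by linarith [hy.1], by linarith [hy.2]⟩, hy.2.ne⟩
          · rintro y y' h1 h2 ⟨t, ht⟩ h4 h5 h6
            have := abs_lt.1 (hclose t y' h1 ht)
            exact ⟨by linarith [this.1], (return_side hs hF hX hpI hp0 h4 h5 h6).2 h2.2⟩
        · exact h
        · exfalso
          refine hno (Ioo p (p + δ)) isPreconnected_Ioo ?_ ?_ y0 ⟨h, by linarith [hc0.2]⟩ hy0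
            ⟨t0, ht0⟩
          · intro y hy
            exact ⟨abs_lt.2 ⟨by linarith [hy.1], by linarith [hy.2]⟩, hy.1.ne'⟩
          · rintro y y' h1 h2 ⟨t, ht⟩ h4 h5 h6
            have := abs_lt.1 (hclose t y' h1 ht)
            exact ⟨(return_side hs hF hX hpI hp0 h4 h5 h6).1 h2.1, by linarith [this.2]⟩
      rw [hy0p] at ht0
      exact closed_range hs L C hw ht0
  · intro y hy
    constructor
    · rintro ⟨t, ht⟩
      have := closed_left L C (t := t) (by rw [ht]; simp) (by rw [ht]; simpa using hy)
      rw [ht] at this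
      have := congrArg Complex.re this
      simpa using this
    · rintro rfl
      exact ⟨0, hZ0⟩

end geom


section asym

/-- The perturbation polynomial in the upper zone. -/
noncomputable def hh (a1 b0 b2 b4 : ℝ) (z : ℂ) : ℂ :=
  I * b0 + a1 * z + I * b2 * z ^ 2 + I * b4 * z ^ 4

/-- First order term of the first integral along `Im z = 1`. -/
noncomputable def psi (a1 b0 b2 b4 ξ : ℝ) : ℝ :=
  -a1 * Real.arctan ξ - b0 * (ξ / (1 + ξ ^ 2)) + b2 * ξ + b4 * (ξ ^ 3 / 3 - ξ)

lemma psi_deriv (a1 b0 b2 b4 ξ : ℝ) : HasDerivAt (psi a1 b0 b2 b4)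
    (-a1 * (1 / (1 + ξ ^ 2)) - b0 * ((1 - ξ ^ 2) / (1 + ξ ^ 2) ^ 2) + b2 + b4 * (ξ ^ 2 - 1)) ξ := by
  have hp : (1 + ξ ^ 2) ≠ 0 := by positivity
  have h1 : HasDerivAt (fun x : ℝ => 1 + x ^ 2) (2 * ξ) ξ := by
    simpa using ((hasDerivAt_id ξ).pow 2).const_add 1
  have h2 := (hasDerivAt_id ξ).div h1 hp
  have h3 : HasDerivAt (fun x : ℝ => x ^ 3 / 3 - x) (ξ ^ 2 - 1) ξ := by
    have := (((hasDerivAt_id ξ).pow 3).div_const 3).sub (hasDerivAt_id ξ)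
    exact this.congr_deriv (by simp)
  have h4 := ((((Real.hasDerivAt_arctan ξ).const_mul (-a1)).sub (h2.const_mul b0)).add
    ((hasDerivAt_id ξ).const_mul b2)).add (h3.const_mul b4)
  refine HasDerivAt.congr_deriv (f := psi a1 b0 b2 b4) h4 ?_
  simp only [id]
  field_simp
  ring

lemma im_main (a1 b0 b2 b4 ε ξ : ℝ) :
    ((I * ((ξ : ℂ) + I))⁻¹ - ε * hh a1 b0 b2 b4 (ξ + I) / (I * ((ξ : ℂ) + I)) ^ 2).im
      = -(ξ / (1 + ξ ^ 2)) + ε * (-a1 * (1 / (1 + ξ ^ 2))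
        - b0 * ((1 - ξ ^ 2) / (1 + ξ ^ 2) ^ 2) + b2 + b4 * (ξ ^ 2 - 1)) := by
  have hp : (1 + ξ ^ 2) ≠ 0 := by positivity
  have hpc : (1 + (ξ : ℂ) ^ 2) ≠ 0 := by exact_mod_cast hp
  have hz : (ξ : ℂ) + I ≠ 0 := by
    intro h; have := congrArg Complex.im h; simp at this
  have hI2 : I ^ 2 = -1 := I_sq
  have hinv : ((ξ : ℂ) + I)⁻¹ = (ξ - I) / (1 + (ξ : ℂ) ^ 2) := by
    rw [eq_div_iff hpc, inv_mul_eq_iff_eq_mul₀ hz]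
    linear_combination hI2
  have e1 : (I * ((ξ : ℂ) + I))⁻¹ = ((-(1 / (1 + ξ ^ 2)) : ℝ) : ℂ) + ((-(ξ / (1 + ξ ^ 2)) : ℝ) : ℂ) * I := by
    rw [mul_inv, hinv, inv_I]
    push_cast
    field_simp
    linear_combination hI2
  have e2 : ε * hh a1 b0 b2 b4 (ξ + I) / (I * ((ξ : ℂ) + I)) ^ 2 =
      -(ε * (I * b0 * (((ξ : ℂ) + I)⁻¹) ^ 2 + a1 * ((ξ : ℂ) + I)⁻¹ + I * b2
        + I * b4 * (ξ + I) ^ 2)) := by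
    unfold hh
    rw [mul_pow, hI2]
    field_simp
  have e3 : (((ξ : ℂ) + I)⁻¹) ^ 2 = (((ξ ^ 2 - 1) / (1 + ξ ^ 2) ^ 2 : ℝ) : ℂ)
      + ((-(2 * ξ) / (1 + ξ ^ 2) ^ 2 : ℝ) : ℂ) * I := by
    rw [hinv]
    push_cast
    field_simp
    linear_combination hI2
  have e4 : ((ξ : ℂ) + I)⁻¹ = ((ξ / (1 + ξ ^ 2) : ℝ) : ℂ) + ((-(1 / (1 + ξ ^ 2)) : ℝ) : ℂ) * I := by
    rw [hinv]
    push_cast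
    field_simp
    ring
  have e5 : ((ξ : ℂ) + I) ^ 2 = ((ξ ^ 2 - 1 : ℝ) : ℂ) + ((2 * ξ : ℝ) : ℂ) * I := by
    push_cast
    linear_combination hI2
  rw [e2, e1, e3, e4, e5]
  simp only [sub_im, add_im, neg_im, mul_im, mul_re, add_re, ofReal_re, ofReal_im, I_re, I_im]
  field_simp
  ring

/-- The approximate first integral. -/
noncomputable def QQ0 (a1 b0 b2 b4 ε ξ : ℝ) : ℝ :=
  -(Real.log (1 + ξ ^ 2) / 2) + ε * psi a1 b0 b2 b4 ξ

variable {a1 b0 b2 b4 ε H μ : ℝ} {F : ℂ → ℂ} {X : ℝ → ℝ}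

lemma QQ_diff_deriv (hε : 0 ≤ ε) (hF : IsPrim (fun z => ε * hh a1 b0 b2 b4 z) F)
    (hH : ∀ z : ℂ, ‖z‖ ≤ 200 → ‖hh a1 b0 b2 b4 z‖ ≤ H) (hεH : ε * H ≤ 1 / 10 ^ 5)
    {ξ : ℝ} (h1 : -69 / 10 ≤ ξ) (h2 : ξ ≤ 69 / 10) :
    ∃ d, HasDerivAt (fun x => QQ F x - QQ0 a1 b0 b2 b4 ε x) d ξ ∧ ‖d‖ ≤ 2 * (ε * H) ^ 2 := by
  have q1 := QQ_deriv hF h1 h2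
  have q2 : HasDerivAt (fun x : ℝ => Real.log (1 + x ^ 2) / 2) (ξ / (1 + ξ ^ 2)) ξ := by
    have := NN_deriv 0 ξ
    have h0 : NN 0 = fun x : ℝ => Real.log (1 + x ^ 2) / 2 := by
      funext x
      simp [NN]
    rw [h0] at this
    simpa using this
  have q3 := q1.sub (q2.neg.add ((psi_deriv a1 b0 b2 b4 ξ).const_mul ε))
  refine ⟨_, q3, ?_⟩
  rw [← im_main a1 b0 b2 b4 ε ξ, ← sub_im]
  refine (abs_im_le_norm _).trans ?_
  set z : ℂ := (ξ : ℂ) + I with hz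
  set d : ℂ := ε * hh a1 b0 b2 b4 z with hd
  obtain ⟨b1, b2'⟩ := big_im (line_mem h1 h2)
  have hn : 1 ≤ ‖I * z‖ := by
    have := (abs_le.1 (abs_im_le_norm z)).2
    simp only [norm_mul, norm_I, one_mul]
    have h3 := abs_im_le_norm z
    simpa [hz] using h3
  have hdn : ‖d‖ ≤ ε * H := by
    rw [hd, norm_mul, norm_real, Real.norm_of_nonneg hε]
    exact mul_le_mul_of_nonneg_left (hH z b2') hε
  have hgn : 1 / 2 ≤ ‖I * z + d‖ := by
    have := norm_sub_le (I * z + d) d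
    rw [add_sub_cancel_right] at this
    norm_num at hεH
    linarith
  have w0 : I * z ≠ 0 := norm_pos_iff.1 (by linarith)
  have g0 : I * z + d ≠ 0 := norm_pos_iff.1 (by linarith)
  have key : (I * z + d)⁻¹ - ((I * z)⁻¹ - d / (I * z) ^ 2) =
      d ^ 2 / ((I * z) ^ 2 * (I * z + d)) := by
    generalize I * z = w at w0 g0
    field_simp
    ring
  rw [key, norm_div, norm_mul, norm_pow, norm_pow]
  have hd0 := norm_nonneg d
  have p1 : ‖d‖ ^ 2 ≤ (ε * H) ^ 2 := by gcongr
  have p2 : 1 / 2 ≤ ‖I * z‖ ^ 2 * ‖I * z + d‖ := by nlinarith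
  rw [div_le_iff₀ (by linarith)]
  nlinarith [sq_nonneg (ε * H)]

lemma DD_approx (hε : 0 ≤ ε) (hF : IsPrim (fun z => ε * hh a1 b0 b2 b4 z) F)
    (hH : ∀ z : ℂ, ‖z‖ ≤ 200 → ‖hh a1 b0 b2 b4 z‖ ≤ H) (hεH : ε * H ≤ 1 / 10 ^ 5)
    {a : ℝ} (hμ : |ε * a| ≤ 1 / 10 ^ 5) (hX : IsX (ε * a) X) {y : ℝ} (hy : y ∈ Icc (1 / 4 : ℝ) 4) :
    |DD F X y - ε * (a * (Real.arctan (X y) + Real.arctan y - 2 * Real.pi)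
      + psi a1 b0 b2 b4 (X y) - psi a1 b0 b2 b4 (-y))| ≤ 20 * (ε * H) ^ 2 := by
  have hyI : y ∈ Icc (6 / 25 : ℝ) (9 / 2) := ⟨by linarith [hy.1], by linarith [hy.2]⟩
  have hXm := X_mem hμ hX hyI
  have hN := (hX y hyI).2
  have hmv : ‖(QQ F (X y) - QQ0 a1 b0 b2 b4 ε (X y)) - (QQ F (-y) - QQ0 a1 b0 b2 b4 ε (-y))‖
      ≤ 2 * (ε * H) ^ 2 * ‖X y - -y‖ := by
    have hc : Convex ℝ (Icc (-69 / 10 : ℝ) (69 / 10)) := convex_Icc _ _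
    choose! d hd1 hd2 using fun ξ (hξ : ξ ∈ Icc (-69 / 10 : ℝ) (69 / 10)) =>
      QQ_diff_deriv hε hF hH hεH hξ.1 hξ.2
    exact hc.norm_image_sub_le_of_norm_hasDerivWithin_le
      (fun ξ hξ => (hd1 ξ hξ).hasDerivWithinAt) hd2
      ⟨by linarith [hy.2], by linarith [hy.1]⟩ ⟨by linarith [hXm.1], by linarith [hXm.2]⟩
  rw [Real.norm_eq_abs, Real.norm_eq_abs, abs_of_nonneg (by linarith [hXm.1, hy.1] : 0 ≤ X y - -y)] at hmv
  have hle : 2 * (ε * H) ^ 2 * (X y - -y) ≤ 20 * (ε * H) ^ 2 := by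
    nlinarith [sq_nonneg (ε * H), hXm.2, hy.2]
  refine le_trans (le_of_eq ?_) (hmv.trans hle)
  congr 1
  unfold NN at hN
  unfold DD QQ0
  rw [neg_sq]
  linear_combination -hN

lemma DD_sign_ev {a y s : ℝ} (hy : y ∈ Icc (1 / 4 : ℝ) 4) (hs : |s| = 1)
    (hH : ∀ z : ℂ, ‖z‖ ≤ 200 → ‖hh a1 b0 b2 b4 z‖ ≤ H)
    (hM : 0 < s * (a * (Real.arctan y - Real.pi) + psi a1 b0 b2 b4 y)) :
    ∀ᶠ ε : ℝ in 𝓝[>] 0, ∀ F X, IsPrim (fun z => ε * hh a1 b0 b2 b4 z) F → IsX (ε * a) X →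
      0 < s * DD F X y := by
  set G : ℝ → ℝ := fun x => s * (a * (Real.arctan x + Real.arctan y - 2 * Real.pi)
      + psi a1 b0 b2 b4 x - psi a1 b0 b2 b4 (-y)) with hG
  set m := s * (a * (Real.arctan y - Real.pi) + psi a1 b0 b2 b4 y) with hm
  have hGy : G y = 2 * m := by
    simp only [hG, hm, psi, Real.arctan_neg, neg_sq]
    ring
  have hGc : ContinuousAt G y := by
    have := (psi_deriv a1 b0 b2 b4 y).continuousAt
    have h2 := Real.continuous_arctan.continuousAt (x := y)
    fun_prop
  have hev : ∀ᶠ x in 𝓝 y, m < G x := hGc.eventually (lt_mem_nhds (by linarith))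
  obtain ⟨δ, hδ, hev⟩ := Metric.eventually_nhds_iff.1 hev
  have t0 : Tendsto (fun ε : ℝ => ε) (𝓝[>] 0) (𝓝 0) := tendsto_nhdsWithin_of_tendsto_nhds tendsto_id
  have ev : ∀ c r : ℝ, 0 < r → ∀ᶠ ε : ℝ in 𝓝[>] 0, ε * c < r := by
    intro c r hr
    have := t0.mul_const c
    rw [zero_mul] at this
    exact this.eventually (gt_mem_nhds hr)
  filter_upwards [self_mem_nhdsWithin, ev H (1 / 10 ^ 5) (by norm_num),
    ev |a| (1 / 10 ^ 5) (by norm_num), ev (100 * |a|) δ hδ, ev (20 * H ^ 2) m hM]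
    with ε hε h1 h2 h3 h4 F X hF hX
  have hε : 0 < ε := hε
  have hab : |ε * a| = ε * |a| := by rw [abs_mul, abs_of_pos hε]
  have hD := DD_approx hε.le hF hH h1.le (by rw [hab]; exact h2.le) hX hy
  have hyI : y ∈ Icc (6 / 25 : ℝ) (9 / 2) := ⟨by linarith [hy.1], by linarith [hy.2]⟩
  have hXy := (hX y hyI).1
  have hGX : m < G (X y) := hev (by rw [Real.dist_eq]; rw [hab] at hXy; linarith)
  set R := DD F X y - ε * (a * (Real.arctan (X y) + Real.arctan y - 2 * Real.pi)
      + psi a1 b0 b2 b4 (X y) - psi a1 b0 b2 b4 (-y)) with hR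
  have hDR : s * DD F X y = ε * G (X y) + s * R := by simp only [hR, hG]; ring
  have hsR : -(20 * (ε * H) ^ 2) ≤ s * R := by
    have : |s * R| ≤ 20 * (ε * H) ^ 2 := by rw [abs_mul, hs, one_mul]; exact hD
    exact (abs_le.1 this).1
  rw [hDR]
  nlinarith

lemma hh_bound (a1 b0 b2 b4 : ℝ) : ∃ H, ∀ z : ℂ, ‖z‖ ≤ 200 → ‖hh a1 b0 b2 b4 z‖ ≤ H := by
  have hc : Continuous (hh a1 b0 b2 b4) := by unfold hh; fun_prop
  obtain ⟨H, hH⟩ := (isCompact_closedBall (0 : ℂ) 200).exists_bound_of_continuousOn hc.continuousOn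
  exact ⟨H, fun z hz => hH z (by simpa using hz)⟩

lemma smallPert_ev (a a1 b0 b2 b4 : ℝ) :
    ∀ᶠ ε : ℝ in 𝓝[>] 0, SmallPert (fun z => ε * hh a1 b0 b2 b4 z) (ε * a) := by
  obtain ⟨H, hH⟩ := hh_bound a1 b0 b2 b4
  have t0 : Tendsto (fun ε : ℝ => ε) (𝓝[>] 0) (𝓝 0) := tendsto_nhdsWithin_of_tendsto_nhds tendsto_id
  have ev : ∀ c r : ℝ, 0 < r → ∀ᶠ ε : ℝ in 𝓝[>] 0, ε * c < r := by
    intro c r hr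
    have := t0.mul_const c
    rw [zero_mul] at this
    exact this.eventually (gt_mem_nhds hr)
  filter_upwards [self_mem_nhdsWithin, ev H (1 / 10 ^ 5) (by norm_num),
    ev |a| (1 / 10 ^ 5) (by norm_num)] with ε hε h1 h2
  have hε : 0 < ε := hε
  refine ⟨by unfold hh; fun_prop, fun z hz => ?_, ?_⟩
  · rw [norm_mul, norm_real, Real.norm_of_nonneg hε.le]
    exact (mul_le_mul_of_nonneg_left (hH z hz) hε.le).trans h1.le
  · rw [abs_mul, abs_of_pos hε]; exact h2.le

end asym


section final

lemma sqrt_three_bounds : (17320 / 10000 : ℝ) < √3 ∧ √3 < 17321 / 10000 ∧ √3 ^ 2 = 3 := by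
  refine ⟨?_, ?_, Real.sq_sqrt (by norm_num)⟩
  · rw [Real.lt_sqrt (by norm_num)]; norm_num
  · rw [Real.sqrt_lt' (by norm_num)]; norm_num

lemma arctan_p1 : Real.arctan (2 - √3) = Real.pi / 12 := by
  obtain ⟨h1, h2, h3⟩ := sqrt_three_bounds
  have := Real.two_mul_arctan (x := 2 - √3) (by linarith) (by linarith)
  have e : 2 * (2 - √3) / (1 - (2 - √3) ^ 2) = (√3)⁻¹ := by
    have : 1 - (2 - √3) ^ 2 ≠ 0 := by nlinarith
    rw [div_eq_iff this]
    field_simp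
    nlinarith
  rw [e, Real.arctan_inv_sqrt_three] at this
  linarith

lemma arctan_p5 : Real.arctan (2 + √3) = 5 * Real.pi / 12 := by
  obtain ⟨h1, h2, h3⟩ := sqrt_three_bounds
  have := Real.arctan_inv_of_pos (x := 2 - √3) (by linarith)
  have e : (2 - √3)⁻¹ = 2 + √3 := by
    rw [inv_eq_iff_eq_inv, eq_comm, inv_eq_of_mul_eq_one_right]
    nlinarith
  rw [e, arctan_p1] at this
  linarith

/-- coefficients -/
noncomputable def cA : ℝ := -(6787 / 1000) / Real.pi
noncomputable def cA1 : ℝ := cA - 12 * (4153 / 100) / Real.pi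
noncomputable def cB0 : ℝ := 101904 / 1000
noncomputable def cB4 : ℝ := 3 * (2248 / 1000)
noncomputable def cB2 : ℝ := -(81673 / 1000) + 3 * (2248 / 1000)

lemma melnikov {y k : ℝ} (h : Real.arctan y = k * Real.pi / 12) :
    cA * (Real.arctan y - Real.pi) + psi cA1 cB0 cB2 cB4 y =
      6787 / 1000 + k * (4153 / 100) - 101904 / 1000 * (y / (1 + y ^ 2))
        - 81673 / 1000 * y + 2248 / 1000 * y ^ 3 := by
  have := Real.pi_ne_zero
  unfold psi cA1 cB0 cB2 cB4 cA
  rw [h]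
  field_simp
  ring

/-- The five test points. -/
noncomputable def tp : Fin 5 → ℝ := ![2 - √3, (√3)⁻¹, 1, √3, 2 + √3]
/-- The alternating signs. -/
noncomputable def sg : Fin 5 → ℝ := ![1, -1, 1, -1, 1]

lemma tp_mem (k : Fin 5) : tp k ∈ Icc (1 / 4 : ℝ) 4 := by
  obtain ⟨h1, h2, h3⟩ := sqrt_three_bounds
  have hi : (√3)⁻¹ = √3 / 3 := by
    rw [inv_eq_iff_eq_inv, eq_comm, inv_eq_of_mul_eq_one_right]; nlinarith
  fin_cases k <;> simp only [tp] <;> constructor <;> simp <;> linarith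

lemma tp_sign (k : Fin 5) : 0 < sg k * (cA * (Real.arctan (tp k) - Real.pi)
    + psi cA1 cB0 cB2 cB4 (tp k)) := by
  obtain ⟨h1, h2, h3⟩ := sqrt_three_bounds
  have hi : (√3)⁻¹ = √3 / 3 := by
    rw [inv_eq_iff_eq_inv, eq_comm, inv_eq_of_mul_eq_one_right]; nlinarith
  have c3 : √3 ^ 3 = 3 * √3 := by rw [pow_succ, h3]
  have q1 : (2 - √3) / (1 + (2 - √3) ^ 2) = 1 / 4 := by
    rw [div_eq_iff (by positivity)]; nlinarith
  have q5 : (2 + √3) / (1 + (2 + √3) ^ 2) = 1 / 4 := by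
    rw [div_eq_iff (by positivity)]; nlinarith
  have q2 : (√3 / 3) / (1 + (√3 / 3) ^ 2) = √3 / 4 := by
    rw [div_pow, h3]; ring
  have q4 : √3 / (1 + √3 ^ 2) = √3 / 4 := by
    rw [h3]; ring
  have t1 : (2 - √3) ^ 3 = 26 - 15 * √3 := by linear_combination 6 * h3 - c3
  have t5 : (2 + √3) ^ 3 = 26 + 15 * √3 := by linear_combination 6 * h3 + c3
  have t2 : (√3 / 3) ^ 3 = √3 / 9 := by rw [div_pow, c3]; ring
  fin_cases k
  · show 0 < (1 : ℝ) * (cA * (Real.arctan (2 - √3) - Real.pi) + psi cA1 cB0 cB2 cB4 (2 - √3))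
    rw [melnikov (k := 1) (by rw [arctan_p1]; ring), q1, t1]; linarith
  · show 0 < (-1 : ℝ) * (cA * (Real.arctan (√3)⁻¹ - Real.pi) + psi cA1 cB0 cB2 cB4 (√3)⁻¹)
    rw [melnikov (k := 2) (by rw [Real.arctan_inv_sqrt_three]; ring), hi, q2, t2]; linarith
  · show 0 < (1 : ℝ) * (cA * (Real.arctan 1 - Real.pi) + psi cA1 cB0 cB2 cB4 1)
    rw [melnikov (k := 3) (by rw [Real.arctan_one]; ring)]; norm_num
  · show 0 < (-1 : ℝ) * (cA * (Real.arctan √3 - Real.pi) + psi cA1 cB0 cB2 cB4 √3)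
    rw [melnikov (k := 4) (by rw [Real.arctan_sqrt_three]; ring), q4, c3]; linarith
  · show 0 < (1 : ℝ) * (cA * (Real.arctan (2 + √3) - Real.pi) + psi cA1 cB0 cB2 cB4 (2 + √3))
    rw [melnikov (k := 5) (by rw [arctan_p5]), q5, t5]; linarith

lemma tp_lt (k : Fin 4) : tp k.castSucc < tp k.succ := by
  obtain ⟨h1, h2, h3⟩ := sqrt_three_bounds
  have hi : (√3)⁻¹ = √3 / 3 := by
    rw [inv_eq_iff_eq_inv, eq_comm, inv_eq_of_mul_eq_one_right]; nlinarith
  fin_cases k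
  · show 2 - √3 < (√3)⁻¹
    linarith
  · show (√3)⁻¹ < 1
    linarith
  · show 1 < √3
    linarith
  · show √3 < 2 + √3
    linarith

lemma tp_mono : StrictMono tp := Fin.strictMono_iff_lt_succ.2 tp_lt

lemma sg_abs (k : Fin 5) : |sg k| = 1 := by fin_cases k <;> simp [sg]

lemma sg_step (k : Fin 4) : sg k.castSucc * sg k.succ = -1 := by
  fin_cases k <;> simp [sg]

/-- All smallness and sign conditions hold for small positive parameters. -/
lemma good_ev : ∀ᶠ ε : ℝ in 𝓝[>] 0, SmallPert (fun z => ε * hh cA1 cB0 cB2 cB4 z) (ε * cA) ∧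
    ∀ k, ∀ F X, IsPrim (fun z => ε * hh cA1 cB0 cB2 cB4 z) F → IsX (ε * cA) X →
      0 < sg k * DD F X (tp k) := by
  obtain ⟨H, hH⟩ := hh_bound cA1 cB0 cB2 cB4
  have h1 : ∀ᶠ ε : ℝ in 𝓝[>] 0, ∀ k, ∀ F X,
      IsPrim (fun z => ε * hh cA1 cB0 cB2 cB4 z) F → IsX (ε * cA) X →
      0 < sg k * DD F X (tp k) :=
    eventually_all.2 fun k => DD_sign_ev (tp_mem k) (sg_abs k) hH (tp_sign k)
  exact (smallPert_ev _ _ _ _ _).and h1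

/-- Coefficients for the frozen statement. -/
noncomputable def coA : Fin 3 → Fin 5 → ℝ :=
  ![![0, cA1, 0, 0, 0], ![0, cA, 0, 0, 0], ![0, cA, 0, 0, 0]]
noncomputable def coB : Fin 3 → Fin 5 → ℝ :=
  ![![cB0, 0, cB2, 0, cB4], ![0, 0, 0, 0, 0], ![0, 0, 0, 0, 0]]

lemma field_eq (ε : ℝ) : (fun (σ : Fin 3) (w : ℂ) => Complex.I * w +
      (ε : ℂ) * ∑ j : Fin 5, ((coA σ j : ℂ) + Complex.I * (coB σ j : ℂ)) * w ^ (j : ℕ)) =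
    pwField (fun z => ε * hh cA1 cB0 cB2 cB4 z) (ε * cA) := by
  funext σ w
  fin_cases σ
  · simp [Fin.sum_univ_five, coA, coB, pwField, hh]
  · simp [Fin.sum_univ_five, coA, coB, pwField]
    ring
  · simp [Fin.sum_univ_five, coA, coB, pwField]
    ring

end final

/-- **Theorem A.** For the piecewise polynomial holomorphic system
`ż = iz + ε h^σ(z)`, `z ∈ Σ_σ`, with `h^σ(z) = ∑_{j=0}^{4} (a_j^σ + i b_j^σ) z^j`,
there is a choice of real coefficients and `ε₀ > 0` such that for every `0 < ε < ε₀`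
the system has at least `4` crossing limit cycles. -/
theorem at_least_four_limit_cycles_lines :
    ∃ (a b : Fin 3 → Fin 5 → ℝ) (ε₀ : ℝ), 0 < ε₀ ∧ ∀ ε : ℝ, 0 < ε → ε < ε₀ →
        ∃ Z : Fin 4 → ℝ → ℂ,
          (∀ k : Fin 4, IsCrossingLimitCycle zonesLines
            (fun σ w => Complex.I * w +
              (ε : ℂ) * ∑ j : Fin 5, ((a σ j : ℂ) + Complex.I * (b σ j : ℂ)) * w ^ (j : ℕ))
            curvesLines (Z k)) ∧
          Function.Injective (fun k : Fin 4 => Set.range (Z k)) := by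
  have hg := good_ev
  rw [eventually_nhdsWithin_iff, Metric.eventually_nhds_iff] at hg
  obtain ⟨ε₀, hε₀, hg⟩ := hg
  refine ⟨coA, coB, ε₀, hε₀, fun ε h0 h1 => ?_⟩
  obtain ⟨hs, hsgn⟩ := hg (y := ε) (by rw [Real.dist_eq, sub_zero, abs_of_pos h0]; exact h1) h0
  rw [field_eq]
  obtain ⟨F, hF⟩ := prim_exists hs
  obtain ⟨X, hX⟩ := X_exists hs.mu
  have key : ∀ k : Fin 4, ∃ Z, IsCrossingLimitCycle zonesLines
      (pwField (fun z => ε * hh cA1 cB0 cB2 cB4 z) (ε * cA)) curvesLines Z ∧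
      ∃ p ∈ Ioo (tp k.castSucc) (tp k.succ),
        ∀ y : ℝ, 0 ≤ y → (-(y : ℂ) + I ∈ range Z ↔ y = p) := by
    intro k
    refine geom hs hF hX (tp_mem _) (tp_mem _) (tp_lt k) ?_
    have e1 := hsgn k.castSucc F X hF hX
    have e2 := hsgn k.succ F X hF hX
    have e3 := sg_step k
    have e4 := mul_pos e1 e2
    have e5 : sg k.castSucc * DD F X (tp k.castSucc) * (sg k.succ * DD F X (tp k.succ)) =
        -(DD F X (tp k.castSucc) * DD F X (tp k.succ)) := by
      linear_combination (DD F X (tp k.castSucc) * DD F X (tp k.succ)) * e3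
    linarith
  choose Z hZ p hp hpZ using key
  refine ⟨Z, hZ, ?_⟩
  have hpos : ∀ k, 0 ≤ p k := fun k => by linarith [(tp_mem k.castSucc).1, (hp k).1]
  have hpm : StrictMono p := by
    intro i j hij
    have : tp i.succ ≤ tp j.castSucc := tp_mono.monotone (by
      rw [Fin.le_def]; simp; exact hij)
    linarith [(hp i).2, (hp j).1]
  intro i j hij
  have hij : range (Z i) = range (Z j) := hij
  have h2 : -((p i : ℝ) : ℂ) + I ∈ range (Z j) := by
    rw [← hij]; exact (hpZ i _ (hpos i)).2 rfl
  exact hpm.injective ((hpZ j _ (hpos i)).1 h2)
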